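/- arXiv:1506.08270 — 16 statements merged into one kernel-verified Lean document; each statement's English description precedes it below -/
import Mathlib

section
/- Let F_h be a discrete operator of positive type which is positively homogeneous and satisfies condition (C5_1). If a mesh function u satisfies F_h[u](x) ≥ 0 for all x ∈ Ω_h and u(x) ≤ 0 for all x ∈ ∂Ω_h, then u(x) ≤ 0 for all x ∈ Ω̄_h. -/
/-- Maximum Principle for discrete operators of positive type,
positively homogeneous, satisfying condition (C5_1). -/
theorem maximum_principle_C5_1
    {α : Type*} [DecidableEq α] (Ωh bΩh : Finset α)
    (hdisj : Disjoint Ωh bΩh) (hΩne : Ωh.Nonempty) (hbΩne : bΩh.Nonempty)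
    (Fh : α → ℝ → (α → ℝ) → ℝ)
    (hloc : ∀ x ∈ Ωh, ∀ (z : ℝ) (u v : α → ℝ),
      (∀ y ∈ Ωh ∪ bΩh, y ≠ x → u y = v y) → Fh x z u = Fh x z v)
    (hpos : ∀ x ∈ Ωh, ∀ (z τ : ℝ) (u η : α → ℝ),
      (∀ y ∈ Ωh ∪ bΩh, 0 ≤ η y ∧ η y ≤ τ) →
      Fh x z (u + η) ≥ Fh x z u ∧ Fh x z u ≥ Fh x (z + τ) (u + η))
    (hhom : ∀ x ∈ Ωh, ∀ (t z : ℝ), 0 ≤ t → ∀ u : α → ℝ,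
      Fh x (t * z) (t • u) = t * Fh x z u)
    (hC51 : ∀ x ∈ Ωh, ∀ (z : ℝ) (u η : α → ℝ),
      (∀ y ∈ Ωh ∪ bΩh, 0 ≤ η y) →
      (∃ y ∈ Ωh ∪ bΩh, y ≠ x ∧ 0 < η y) →
      Fh x z (u + η) > Fh x z u)
    (u : α → ℝ)
    (hsub : ∀ x ∈ Ωh, Fh x (u x) u ≥ 0)
    (hbd : ∀ x ∈ bΩh, u x ≤ 0) :
    ∀ x ∈ Ωh ∪ bΩh, u x ≤ 0 := by
  obtain ⟨x₀, hx₀, hmax⟩ := (Ωh ∪ bΩh).exists_max_image u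
    (hΩne.mono Finset.subset_union_left)
  by_contra! hex
  obtain ⟨x, hx, hux⟩ := hex
  have hM : 0 < u x₀ := hux.trans_le (hmax x hx)
  have hx₀Ω : x₀ ∈ Ωh :=
    (Finset.mem_union.mp hx₀).resolve_right fun hb => (hbd x₀ hb).not_gt hM
  obtain ⟨y, hy⟩ := hbΩne
  have hzero : Fh x₀ 0 0 = 0 := by simpa using hhom x₀ hx₀Ω 0 0 le_rfl 0
  have hconst : Fh x₀ (u x₀) (fun _ => u x₀) ≤ 0 := by
    have h := (hpos x₀ hx₀Ω 0 (u x₀) 0 (fun _ => u x₀) fun _ _ => ⟨hM.le, le_rfl⟩).2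
    rwa [zero_add, zero_add, hzero] at h
  have hstrict := hC51 x₀ hx₀Ω (u x₀) u ((fun _ : α => u x₀) - u)
    (fun z hz => sub_nonneg.mpr (hmax z hz))
    ⟨y, Finset.mem_union_right _ hy, by rintro rfl; exact Finset.disjoint_left.mp hdisj hx₀Ω hy,
      sub_pos.mpr ((hbd y hy).trans_lt hM)⟩
  rw [add_sub_cancel] at hstrict
  exact absurd (hsub x₀ hx₀Ω) (hstrict.trans_le hconst).not_ge
end

section
/- Let F_h be a discrete operator of positive type which is positively homogeneous and satisfies condition (C5_2). If a mesh function u satisfies F_h[u](x) ≥ 0 for all x ∈ Ω_h and u(x) ≤ 0 for all x ∈ ∂Ω_h, then u(x) ≤ 0 for all x ∈ Ω̄_h. -/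
/-- Maximum Principle for discrete operators of positive type,
positively homogeneous, satisfying condition (C5_2). -/
theorem maximum_principle_C5_2
    {α : Type*} [DecidableEq α] (Ωh bΩh : Finset α)
    (hdisj : Disjoint Ωh bΩh) (hΩne : Ωh.Nonempty) (hbΩne : bΩh.Nonempty)
    (Fh : α → ℝ → (α → ℝ) → ℝ)
    (hloc : ∀ x ∈ Ωh, ∀ (z : ℝ) (u v : α → ℝ),
      (∀ y ∈ Ωh ∪ bΩh, y ≠ x → u y = v y) → Fh x z u = Fh x z v)
    (hpos : ∀ x ∈ Ωh, ∀ (z τ : ℝ) (u η : α → ℝ),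
      (∀ y ∈ Ωh ∪ bΩh, 0 ≤ η y ∧ η y ≤ τ) →
      Fh x z (u + η) ≥ Fh x z u ∧ Fh x z u ≥ Fh x (z + τ) (u + η))
    (hhom : ∀ x ∈ Ωh, ∀ (t z : ℝ), 0 ≤ t → ∀ u : α → ℝ,
      Fh x (t * z) (t • u) = t * Fh x z u)
    (hC52 : ∃ c₀ : ℝ, 0 < c₀ ∧ ∀ x ∈ Ωh, ∀ (z τ : ℝ) (u η : α → ℝ),
      (∀ y ∈ Ωh ∪ bΩh, 0 ≤ η y ∧ η y ≤ τ) →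
      Fh x z u ≥ Fh x (z + τ) (u + η) + c₀ * τ)
    (u : α → ℝ)
    (hsub : ∀ x ∈ Ωh, Fh x (u x) u ≥ 0)
    (hbd : ∀ x ∈ bΩh, u x ≤ 0) :
    ∀ x ∈ Ωh ∪ bΩh, u x ≤ 0 := by
  by_contra! hcon
  obtain ⟨p, hp, hp0⟩ := hcon
  obtain ⟨x, hx, hmax⟩ := (Ωh ∪ bΩh).exists_max_image u ⟨p, hp⟩
  have hM : 0 < u x := hp0.trans_le (hmax p hp)
  have hxΩ : x ∈ Ωh := (Finset.mem_union.mp hx).resolve_right fun h => (hbd x h).not_gt hM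
  obtain ⟨c₀, hc₀, hC⟩ := hC52
  have hη : ∀ y, 0 ≤ max (u y) 0 - u y := fun y => sub_nonneg.mpr (le_max_left _ _)
  have hmono := (hpos x hxΩ (u x) (∑ y ∈ Ωh ∪ bΩh, (max (u y) 0 - u y)) u
    (fun y => max (u y) 0 - u y) fun y hy =>
      ⟨hη y, Finset.single_le_sum (f := fun y => max (u y) 0 - u y) (fun i _ => hη i) hy⟩).1
  have hstrict := hC x hxΩ 0 (u x) 0 (fun y => max (u y) 0) fun y hy =>
    ⟨le_max_right _ _, max_le (hmax y hy) hM.le⟩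
  have hzero : Fh x 0 0 = 0 := by simpa using hhom x hxΩ 0 0 le_rfl 0
  have hw : (u + fun y => max (u y) 0 - u y) = fun y => max (u y) 0 := by
    ext y
    simp
  rw [hw] at hmono
  rw [hzero, zero_add, zero_add] at hstrict
  linarith [hsub x hxΩ, mul_pos hc₀ hM]
end

section
/- Let F_h be a discrete operator of positive type which is positively homogeneous. Suppose that for some λ ∈ ℝ there exists a mesh function φ with φ(y) ≥ 0 for all y ∈ Ω̄_h, φ(x) > 0 for all x ∈ Ω_h, and F_h[φ](x) + λφ(x) ≤ 0 for all x ∈ Ω_h. Then for every τ < λ, any mesh function u satisfying F_h[u](x) + τu(x) ≥ 0 for all x ∈ Ω_h and u(x) ≤ 0 for all x ∈ ∂Ω_h satisfies u(x) ≤ 0 for all x ∈ Ω̄_h (i.e. the Maximum Principle holds for F_h + τ). -/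
/-- If there is a positive function φ with F_h[φ] + λφ ≤ 0 in Ω_h, then
for every τ < λ the operator F_h + τ satisfies the Maximum Principle. -/
theorem maximum_principle_below_eigenvalue
    {α : Type*} [DecidableEq α] (Ωh bΩh : Finset α)
    (hdisj : Disjoint Ωh bΩh) (hΩne : Ωh.Nonempty) (hbΩne : bΩh.Nonempty)
    (Fh : α → ℝ → (α → ℝ) → ℝ)
    (hloc : ∀ x ∈ Ωh, ∀ (z : ℝ) (u v : α → ℝ),
      (∀ y ∈ Ωh ∪ bΩh, y ≠ x → u y = v y) → Fh x z u = Fh x z v)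
    (hpos : ∀ x ∈ Ωh, ∀ (z τ : ℝ) (u η : α → ℝ),
      (∀ y ∈ Ωh ∪ bΩh, 0 ≤ η y ∧ η y ≤ τ) →
      Fh x z (u + η) ≥ Fh x z u ∧ Fh x z u ≥ Fh x (z + τ) (u + η))
    (hhom : ∀ x ∈ Ωh, ∀ (t z : ℝ), 0 ≤ t → ∀ u : α → ℝ,
      Fh x (t * z) (t • u) = t * Fh x z u)
    (lam : ℝ) (φ : α → ℝ)
    (hφ0 : ∀ y ∈ Ωh ∪ bΩh, 0 ≤ φ y) (hφpos : ∀ x ∈ Ωh, 0 < φ x)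
    (hφ : ∀ x ∈ Ωh, Fh x (φ x) φ + lam * φ x ≤ 0)
    (τ : ℝ) (hτ : τ < lam)
    (u : α → ℝ)
    (hsub : ∀ x ∈ Ωh, Fh x (u x) u + τ * u x ≥ 0)
    (hbd : ∀ x ∈ bΩh, u x ≤ 0) :
    ∀ x ∈ Ωh ∪ bΩh, u x ≤ 0 := by
  obtain ⟨x₀, hx₀, hmax⟩ := Finset.exists_max_image Ωh (fun x => u x / φ x) hΩne
  have hφx₀ := hφpos x₀ hx₀
  obtain ⟨t, ht⟩ : ∃ t, t = u x₀ / φ x₀ := ⟨_, rfl⟩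
  have hux₀ : u x₀ = t * φ x₀ := by rw [ht]; field_simp
  have hle : ∀ x ∈ Ωh, u x ≤ t * φ x := fun x hx => by
    rw [ht]
    exact (div_le_iff₀ (hφpos x hx)).1 (hmax x hx)
  have htle : t ≤ 0 := by
    by_contra! htpos
    have hη : ∀ y ∈ Ωh ∪ bΩh, 0 ≤ (t • φ - u) y := fun y hy => by
      simp only [Pi.sub_apply, Pi.smul_apply, smul_eq_mul, sub_nonneg]
      rcases Finset.mem_union.1 hy with h | h
      · exact hle y h
      · exact (hbd y h).trans (mul_nonneg htpos.le (hφ0 y hy))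
    have hmono := (hpos x₀ hx₀ (u x₀) (∑ y ∈ Ωh ∪ bΩh, (t • φ - u) y) u (t • φ - u)
      fun y hy => ⟨hη y hy, Finset.single_le_sum hη hy⟩).1
    rw [add_sub_cancel] at hmono
    have hscale := hhom x₀ hx₀ t (φ x₀) htpos.le φ
    rw [← hux₀] at hscale
    have hsuper := mul_le_mul_of_nonneg_left (hφ x₀ hx₀) htpos.le
    have hsub₀ := hsub x₀ hx₀
    rw [hux₀] at hsub₀ hscale hmono
    nlinarith [mul_pos (sub_pos.2 hτ) (mul_pos htpos hφx₀)]
  intro x hx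
  rcases Finset.mem_union.1 hx with h | h
  · exact (hle x h).trans (mul_nonpos_of_nonpos_of_nonneg htle (hφ0 x hx))
  · exact hbd x h
end

section
/- Let F_h be a discrete operator of positive type satisfying condition (C5_1), and let f : Ω_h → ℝ. If u and v are mesh functions with F_h[u](x) ≥ f(x) and F_h[v](x) ≤ f(x) for all x ∈ Ω_h (u is a subsolution and v is a supersolution), and u(x) ≤ v(x) for all x ∈ ∂Ω_h, then u(x) ≤ v(x) for all x ∈ Ω̄_h. -/
/-- Comparison principle for discrete operators of positive type
satisfying condition (C5_1). -/
theorem comparison_principle_C5_1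
    {α : Type*} [DecidableEq α] (Ωh bΩh : Finset α)
    (hdisj : Disjoint Ωh bΩh) (hΩne : Ωh.Nonempty) (hbΩne : bΩh.Nonempty)
    (Fh : α → ℝ → (α → ℝ) → ℝ)
    (hloc : ∀ x ∈ Ωh, ∀ (z : ℝ) (u v : α → ℝ),
      (∀ y ∈ Ωh ∪ bΩh, y ≠ x → u y = v y) → Fh x z u = Fh x z v)
    (hpos : ∀ x ∈ Ωh, ∀ (z τ : ℝ) (u η : α → ℝ),
      (∀ y ∈ Ωh ∪ bΩh, 0 ≤ η y ∧ η y ≤ τ) →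
      Fh x z (u + η) ≥ Fh x z u ∧ Fh x z u ≥ Fh x (z + τ) (u + η))
    (hC51 : ∀ x ∈ Ωh, ∀ (z : ℝ) (u η : α → ℝ),
      (∀ y ∈ Ωh ∪ bΩh, 0 ≤ η y) →
      (∃ y ∈ Ωh ∪ bΩh, y ≠ x ∧ 0 < η y) →
      Fh x z (u + η) > Fh x z u)
    (f : α → ℝ) (u v : α → ℝ)
    (hsub : ∀ x ∈ Ωh, Fh x (u x) u ≥ f x)
    (hsup : ∀ x ∈ Ωh, Fh x (v x) v ≤ f x)
    (hbd : ∀ x ∈ bΩh, u x ≤ v x) :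
    ∀ x ∈ Ωh ∪ bΩh, u x ≤ v x := by
  by_contra! hcon
  obtain ⟨x₀, hx₀, huv₀⟩ := hcon
  obtain ⟨x, hx, hmax⟩ :=
    Finset.exists_max_image (Ωh ∪ bΩh) (fun y => u y - v y) ⟨x₀, hx₀⟩
  set M := u x - v x with hM
  have hMpos : 0 < M := by linarith [hmax x₀ hx₀]
  have hxΩ : x ∈ Ωh := by
    rcases Finset.mem_union.mp hx with h | h
    · exact h
    · linarith [hbd x h]
  obtain ⟨b, hb⟩ := hbΩne
  have hstrict := hC51 x hxΩ (u x) u (fun y => v y + M - u y)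
    (fun y hy => by linarith [hmax y hy])
    ⟨b, Finset.mem_union_right _ hb, fun h => Finset.disjoint_left.mp hdisj hxΩ (h ▸ hb),
      by linarith [hbd b hb]⟩
  have hshift := (hpos x hxΩ (v x) M v (fun _ => M) fun _ _ => ⟨hMpos.le, le_rfl⟩).2
  have hfun : (u + fun y => v y + M - u y) = v + fun _ => M := by
    funext y
    simp
  have hval : v x + M = u x := by rw [hM]; ring
  rw [hfun] at hstrict
  rw [hval] at hshift
  linarith [hsub x hxΩ, hsup x hxΩ]
end

section
/- Let F_h be a discrete operator of positive type satisfying condition (C5_2), and let f : Ω_h → ℝ. If u and v are mesh functions with F_h[u](x) ≥ f(x) and F_h[v](x) ≤ f(x) for all x ∈ Ω_h (u is a subsolution and v is a supersolution), and u(x) ≤ v(x) for all x ∈ ∂Ω_h, then u(x) ≤ v(x) for all x ∈ Ω̄_h. -/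
/-- Comparison principle for discrete operators of positive type
satisfying condition (C5_2). -/
theorem comparison_principle_C5_2
    {α : Type*} [DecidableEq α] (Ωh bΩh : Finset α)
    (hdisj : Disjoint Ωh bΩh) (hΩne : Ωh.Nonempty) (hbΩne : bΩh.Nonempty)
    (Fh : α → ℝ → (α → ℝ) → ℝ)
    (hloc : ∀ x ∈ Ωh, ∀ (z : ℝ) (u v : α → ℝ),
      (∀ y ∈ Ωh ∪ bΩh, y ≠ x → u y = v y) → Fh x z u = Fh x z v)
    (hpos : ∀ x ∈ Ωh, ∀ (z τ : ℝ) (u η : α → ℝ),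
      (∀ y ∈ Ωh ∪ bΩh, 0 ≤ η y ∧ η y ≤ τ) →
      Fh x z (u + η) ≥ Fh x z u ∧ Fh x z u ≥ Fh x (z + τ) (u + η))
    (hC52 : ∃ c₀ : ℝ, 0 < c₀ ∧ ∀ x ∈ Ωh, ∀ (z τ : ℝ) (u η : α → ℝ),
      (∀ y ∈ Ωh ∪ bΩh, 0 ≤ η y ∧ η y ≤ τ) →
      Fh x z u ≥ Fh x (z + τ) (u + η) + c₀ * τ)
    (f : α → ℝ) (u v : α → ℝ)
    (hsub : ∀ x ∈ Ωh, Fh x (u x) u ≥ f x)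
    (hsup : ∀ x ∈ Ωh, Fh x (v x) v ≤ f x)
    (hbd : ∀ x ∈ bΩh, u x ≤ v x) :
    ∀ x ∈ Ωh ∪ bΩh, u x ≤ v x := by
  obtain ⟨c₀, hc₀, hC⟩ := hC52
  obtain ⟨x, hx, hmax⟩ := (Ωh ∪ bΩh).exists_max_image (fun y => u y - v y)
    (hΩne.mono Finset.subset_union_left)
  by_contra! ⟨y, hy, hvu⟩
  have hM : 0 < u x - v x := by linarith [hmax y hy]
  have hxΩ : x ∈ Ωh :=
    (Finset.mem_union.mp hx).resolve_right fun hb => by linarith [hbd x hb]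
  have hsup_ge := hC x hxΩ (v x) (u x - v x) v (fun y => max (u y - v y) 0)
    fun y hy => ⟨le_max_right _ _, max_le (hmax y hy) hM.le⟩
  have hmono := (hpos x hxΩ (u x) (∑ y ∈ Ωh ∪ bΩh, max (v y - u y) 0) u
    (fun y => max (v y - u y) 0) fun y hy => ⟨le_max_right _ _,
      Finset.single_le_sum (f := fun y => max (v y - u y) 0)
        (fun _ _ => le_max_right _ _) hy⟩).1
  have hjoin : (v + fun y => max (u y - v y) 0) = u + fun y => max (v y - u y) 0 := by
    funext y
    simp only [Pi.add_apply, ← max_add_add_left, add_sub_cancel, add_zero, max_comm]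
  rw [add_sub_cancel, hjoin] at hsup_ge
  linarith [hsub x hxΩ, hsup x hxΩ, mul_pos hc₀ hM]
end

section
/- Assume that for every (x,z,q,s) ∈ ℝⁿ × ℝ × ℝ^Y × ℝ^Y and every y ∈ Y one has ∂𝓕/∂s_y(x,z,q,s) ≥ (h|y|/2)·|∂𝓕/∂q_y(x,z,q,s)| and ∂𝓕/∂z(x,z,q,s) ≤ 0. Then F_h is of positive type: for all x ∈ ℝⁿ, all z, τ ∈ ℝ and all functions u, η : ℝⁿ → ℝ with 0 ≤ η(ξ) ≤ τ for every ξ ∈ ℝⁿ, one has F_h(x,z,u+η) ≥ F_h(x,z,u) ≥ F_h(x,z+τ,u+η). -/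
/-- Euclidean norm of an integer vector. -/
noncomputable def ynorm {n : ℕ} (y : Fin n → ℤ) : ℝ :=
  Real.sqrt (∑ i, ((y i : ℝ)) ^ 2)

/-- Cast an integer vector to a real vector. -/
def toR {n : ℕ} (y : Fin n → ℤ) : Fin n → ℝ := fun i => (y i : ℝ)

/-- The finite difference operator F_h built from 𝓕 via the centered first and
second difference quotients on the stencil Y. -/
noncomputable def FDop {n : ℕ} (h : ℝ) (Y : Finset (Fin n → ℤ))
    (F : (Fin n → ℝ) → ℝ → (↥Y → ℝ) → (↥Y → ℝ) → ℝ)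
    (x : Fin n → ℝ) (z : ℝ) (u : (Fin n → ℝ) → ℝ) : ℝ :=
  F x z
    (fun y => (u (x + h • toR (y : Fin n → ℤ)) - u (x - h • toR (y : Fin n → ℤ)))
        / (2 * h * ynorm (y : Fin n → ℤ)))
    (fun y => (u (x + h • toR (y : Fin n → ℤ)) + u (x - h • toR (y : Fin n → ℤ)) - 2 * z)
        / (h ^ 2 * (ynorm (y : Fin n → ℤ)) ^ 2))

/-- A `C¹` function of `(z, q, s)` that is nonincreasing in `z` and whose `s`-derivatives dominate
its `q`-derivatives with weights `k` increases along every step that decreases `z` and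
satisfies `|Δq| ≤ k Δs`. -/
theorem le_of_deriv_dominated {ι : Type*} [Fintype ι] [DecidableEq ι]
    (f : ℝ → (ι → ℝ) → (ι → ℝ) → ℝ)
    (hf : Differentiable ℝ (fun p : ℝ × (ι → ℝ) × (ι → ℝ) => f p.1 p.2.1 p.2.2))
    (k : ι → ℝ) (hk : ∀ i, 0 < k i)
    (hs : ∀ z q s i, k i * |deriv (fun t => f z (Function.update q i t) s) (q i)| ≤
      deriv (fun t => f z q (Function.update s i t)) (s i))
    (hz : ∀ z q s, deriv (fun t => f t q s) z ≤ 0)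
    {z z' : ℝ} {q q' s s' : ι → ℝ} (hzz : z' ≤ z)
    (hqs : ∀ i, |q' i - q i| ≤ k i * (s' i - s i)) :
    f z q s ≤ f z' q' s' := by
  set Φ : ℝ × (ι → ℝ) × (ι → ℝ) → ℝ := fun p => f p.1 p.2.1 p.2.2 with hΦ
  have fderiv_z (p : ℝ × (ι → ℝ) × (ι → ℝ)) :
      fderiv ℝ Φ p (1, 0, 0) = deriv (fun t => f t p.2.1 p.2.2) p.1 := by
    have hγ : HasDerivAt (fun t : ℝ => (t, p.2.1, p.2.2)) (1, 0, 0) p.1 :=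
      (hasDerivAt_id p.1).prodMk ((hasDerivAt_const _ _).prodMk (hasDerivAt_const _ _))
    exact ((hf p).hasFDerivAt.comp_hasDerivAt p.1 hγ).deriv.symm
  have fderiv_q (p : ℝ × (ι → ℝ) × (ι → ℝ)) (i : ι) :
      fderiv ℝ Φ p (0, Pi.single i 1, 0) =
        deriv (fun t => f p.1 (Function.update p.2.1 i t) p.2.2) (p.2.1 i) := by
    have hγ : HasDerivAt (fun t : ℝ => (p.1, Function.update p.2.1 i t, p.2.2))
        (0, Pi.single i 1, 0) (p.2.1 i) :=
      (hasDerivAt_const _ _).prodMk ((hasDerivAt_update p.2.1 i _).prodMk (hasDerivAt_const _ _))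
    refine (HasFDerivAt.comp_hasDerivAt (p.2.1 i) (l := Φ) ?_ hγ).deriv.symm
    rw [Function.update_eq_self]
    exact (hf p).hasFDerivAt
  have fderiv_s (p : ℝ × (ι → ℝ) × (ι → ℝ)) (i : ι) :
      fderiv ℝ Φ p (0, 0, Pi.single i 1) =
        deriv (fun t => f p.1 p.2.1 (Function.update p.2.2 i t)) (p.2.2 i) := by
    have hγ : HasDerivAt (fun t : ℝ => (p.1, p.2.1, Function.update p.2.2 i t))
        (0, 0, Pi.single i 1) (p.2.2 i) :=
      (hasDerivAt_const _ _).prodMk ((hasDerivAt_const _ _).prodMk (hasDerivAt_update p.2.2 i _))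
    refine (HasFDerivAt.comp_hasDerivAt (p.2.2 i) (l := Φ) ?_ hγ).deriv.symm
    rw [Function.update_eq_self]
    exact (hf p).hasFDerivAt
  set v : ℝ × (ι → ℝ) × (ι → ℝ) := (z' - z, q' - q, s' - s) with hv
  have hv_sum : v = (z' - z) • ((1, 0, 0) : ℝ × (ι → ℝ) × (ι → ℝ)) +
      ∑ i, ((q' i - q i) • ((0, Pi.single i 1, 0) : ℝ × (ι → ℝ) × (ι → ℝ)) +
        (s' i - s i) • ((0, 0, Pi.single i 1) : ℝ × (ι → ℝ) × (ι → ℝ))) := by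
    ext j <;>
      simp [hv, Prod.fst_sum, Prod.snd_sum, Finset.sum_apply, Pi.single_apply]
  have fderiv_nonneg (p : ℝ × (ι → ℝ) × (ι → ℝ)) : 0 ≤ fderiv ℝ Φ p v := by
    rw [hv_sum]
    simp only [map_add, map_sum, map_smul, smul_eq_mul, fderiv_z, fderiv_q, fderiv_s]
    refine add_nonneg (mul_nonneg_of_nonpos_of_nonpos (sub_nonpos.2 hzz) (hz _ _ _))
      (Finset.sum_nonneg fun i _ => ?_)
    have hΔs : 0 ≤ s' i - s i :=
      nonneg_of_mul_nonneg_right ((abs_nonneg _).trans (hqs i)) (hk i)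
    set dq := deriv (fun t => f p.1 (Function.update p.2.1 i t) p.2.2) (p.2.1 i)
    have hΔq : -((q' i - q i) * dq) ≤ k i * (s' i - s i) * |dq| :=
      (neg_le_abs _).trans (by rw [abs_mul]; gcongr; exact hqs i)
    have := mul_le_mul_of_nonneg_left (hs p.1 p.2.1 p.2.2 i) hΔs
    linarith
  have hline (t : ℝ) :
      HasDerivAt (fun t : ℝ => Φ ((z, q, s) + t • v)) (fderiv ℝ Φ ((z, q, s) + t • v) v) t := by
    have hγ : HasDerivAt (fun t : ℝ => (z, q, s) + t • v) v t := by
      simpa using ((hasDerivAt_id t).smul_const v).const_add (z, q, s)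
    exact (hf _).hasFDerivAt.comp_hasDerivAt t hγ
  have hmono := monotone_of_deriv_nonneg (fun t => (hline t).differentiableAt)
    fun t => (hline t).deriv ▸ fderiv_nonneg _
  simpa [hΦ, hv] using hmono zero_le_one

theorem ynorm_pos {n : ℕ} {y : Fin n → ℤ} (hy : y ≠ 0) : 0 < ynorm y := by
  obtain ⟨i, hi⟩ := Function.ne_iff.1 hy
  refine Real.sqrt_pos.2 (Finset.sum_pos' (fun j _ => sq_nonneg _) ⟨i, Finset.mem_univ i, ?_⟩)
  have : (y i : ℝ) ≠ 0 := Int.cast_ne_zero.2 hi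
  positivity

/-- The step condition on difference quotients, reduced to one on the differenced values. -/
theorem abs_quotient_sub_le {h r a b c d : ℝ} (hh : 0 < h) (hr : 0 < r) (hab : |a - b| ≤ d - c) :
    |a / (2 * h * r) - b / (2 * h * r)| ≤
      h * r / 2 * (d / (h ^ 2 * r ^ 2) - c / (h ^ 2 * r ^ 2)) := by
  have hpos : 0 < 2 * h * r := by positivity
  rw [← sub_div, abs_div, abs_of_pos hpos]
  calc |a - b| / (2 * h * r) ≤ (d - c) / (2 * h * r) := by gcongr
    _ = _ := by field_simp

/-- if ∂𝓕/∂s_y ≥ (h|y|/2)|∂𝓕/∂q_y| and ∂𝓕/∂z ≤ 0 then the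
finite difference operator F_h is of positive type. -/
theorem FDop_positive_type
    (n : ℕ) (hn : 1 ≤ n) (h : ℝ) (hh : 0 < h)
    (Y : Finset (Fin n → ℤ)) (hY0 : (0 : Fin n → ℤ) ∉ Y)
    (F : (Fin n → ℝ) → ℝ → (↥Y → ℝ) → (↥Y → ℝ) → ℝ)
    (hreg : ∀ x : Fin n → ℝ,
      ContDiff ℝ 1 (fun p : ℝ × (↥Y → ℝ) × (↥Y → ℝ) => F x p.1 p.2.1 p.2.2))
    (hs : ∀ (x : Fin n → ℝ) (z : ℝ) (q s : ↥Y → ℝ) (y : ↥Y),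
      deriv (fun t => F x z q (Function.update s y t)) (s y)
        ≥ (h * ynorm (y : Fin n → ℤ) / 2) *
            |deriv (fun t => F x z (Function.update q y t) s) (q y)|)
    (hz : ∀ (x : Fin n → ℝ) (z : ℝ) (q s : ↥Y → ℝ),
      deriv (fun t => F x t q s) z ≤ 0) :
    ∀ (x : Fin n → ℝ) (z τ : ℝ) (u η : (Fin n → ℝ) → ℝ),
      (∀ ξ : Fin n → ℝ, 0 ≤ η ξ ∧ η ξ ≤ τ) →
      FDop h Y F x z (u + η) ≥ FDop h Y F x z u ∧
        FDop h Y F x z u ≥ FDop h Y F x (z + τ) (u + η) := by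
  intro x z τ u η hη
  have hY (y : ↥Y) : 0 < ynorm (y : Fin n → ℤ) :=
    ynorm_pos fun h0 => hY0 (h0 ▸ y.2)
  have hτ : 0 ≤ τ := (hη 0).1.trans (hη 0).2
  have step {z₁ z₂ : ℝ} {q₁ q₂ s₁ s₂ : ↥Y → ℝ} :=
    le_of_deriv_dominated (F x) ((hreg x).differentiable one_ne_zero)
      (fun y => h * ynorm (y : Fin n → ℤ) / 2)
      (fun y => by have := hY y; positivity) (fun z q s y => by convert hs x z q s y) (hz x)
      (z := z₁) (z' := z₂) (q := q₁) (q' := q₂) (s := s₁) (s' := s₂)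
  refine ⟨step le_rfl fun y => abs_quotient_sub_le hh (hY y) ?_,
    step (by linarith) fun y => abs_quotient_sub_le hh (hY y) ?_⟩ <;>
  · have h₁ := hη (x + h • toR (y : Fin n → ℤ))
    have h₂ := hη (x - h • toR (y : Fin n → ℤ))
    simp only [Pi.add_apply]
    rw [abs_le]
    constructor <;> linarith
end

section
/- Assume there is α₀ > 0 such that for every (x,z,q,s) ∈ ℝⁿ × ℝ × ℝ^Y × ℝ^Y and every y ∈ Y one has ∂𝓕/∂s_y(x,z,q,s) − (h|y|/2)·|∂𝓕/∂q_y(x,z,q,s)| ≥ α₀. Then for all x ∈ ℝⁿ, z ∈ ℝ, u : ℝⁿ → ℝ and all η : ℝⁿ → ℝ with η ≥ 0 everywhere, F_h(x,z,u+η) − F_h(x,z,u) ≥ α₀ · Σ_{y∈Y} (η(x+hy) + η(x−hy))/(h²|y|²). In particular F_h(x,z,u+η) > F_h(x,z,u) whenever η(x+hy) > 0 or η(x−hy) > 0 for some y ∈ Y, i.e. the strict monotonicity condition (C5_1) holds. -/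
/-- If every partial derivative of `f` in its second argument dominates `c i` times the absolute
value of the corresponding partial derivative in its first argument with a gap of at least `α`,
then `f` increases at rate at least `α` in directions `(a, b)` with `|a i| ≤ c i * b i`. -/
theorem mul_sum_le_sub_of_partial_deriv_gap {ι : Type*} [Fintype ι] [DecidableEq ι]
    (f : (ι → ℝ) × (ι → ℝ) → ℝ) (hf : Differentiable ℝ f) (c : ι → ℝ) (α : ℝ)
    (hgap : ∀ (q s : ι → ℝ) (i : ι),
      α ≤ deriv (fun t => f (q, Function.update s i t)) (s i) -
        c i * |deriv (fun t => f (Function.update q i t, s)) (q i)|)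
    (q s a b : ι → ℝ) (hb : ∀ i, 0 ≤ b i) (hab : ∀ i, |a i| ≤ c i * b i) :
    α * ∑ i, b i ≤ f (q + a, s + b) - f (q, s) := by
  have hpath (t : ℝ) : HasDerivAt (fun t : ℝ => f (q + t • a, s + t • b))
      (fderiv ℝ f (q + t • a, s + t • b) (a, b)) t := by
    refine (hf _).hasFDerivAt.comp_hasDerivAt t (HasDerivAt.prodMk ?_ ?_)
    · simpa using ((hasDerivAt_id t).smul_const a).const_add q
    · simpa using ((hasDerivAt_id t).smul_const b).const_add s
  have hderiv (q s : ι → ℝ) : α * ∑ i, b i ≤ fderiv ℝ f (q, s) (a, b) := by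
    have hs (i : ι) : deriv (fun t => f (q, Function.update s i t)) (s i) =
        fderiv ℝ f (q, s) (0, Pi.single i 1) := by
      refine HasDerivAt.deriv ?_
      refine HasFDerivAt.comp_hasDerivAt (s i) ?_
        (HasDerivAt.prodMk (hasDerivAt_const _ _) (hasDerivAt_update s i (s i)))
      simpa using (hf (q, s)).hasFDerivAt
    have hq (i : ι) : deriv (fun t => f (Function.update q i t, s)) (q i) =
        fderiv ℝ f (q, s) (Pi.single i 1, 0) := by
      refine HasDerivAt.deriv ?_
      refine HasFDerivAt.comp_hasDerivAt (q i) ?_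
        (HasDerivAt.prodMk (hasDerivAt_update q i (q i)) (hasDerivAt_const _ _))
      simpa using (hf (q, s)).hasFDerivAt
    have hsplit : (a, b) = ∑ i, (a i • ((Pi.single i 1, 0) : (ι → ℝ) × (ι → ℝ)) +
        b i • ((0, Pi.single i 1) : (ι → ℝ) × (ι → ℝ))) := by
      ext j <;> simp [Prod.fst_sum, Prod.snd_sum, Pi.single_apply]
    rw [hsplit, map_sum, Finset.mul_sum]
    refine Finset.sum_le_sum fun i _ => ?_
    rw [map_add, map_smul, map_smul, ← hs, ← hq, smul_eq_mul, smul_eq_mul]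
    set S := deriv (fun t => f (q, Function.update s i t)) (s i)
    set Q := deriv (fun t => f (Function.update q i t, s)) (q i)
    have h₁ : α * b i ≤ (S - c i * |Q|) * b i := mul_le_mul_of_nonneg_right (hgap q s i) (hb i)
    have h₂ : -(a i * Q) ≤ c i * b i * |Q| :=
      (neg_le_abs _).trans (abs_mul (a i) Q ▸ mul_le_mul_of_nonneg_right (hab i) (abs_nonneg Q))
    linarith
  have hmv := mul_sub_le_image_sub_of_le_deriv
    (fun t => (hpath t).differentiableAt)
    (fun t => (hpath t).deriv ▸ hderiv _ _) (zero_le_one (α := ℝ))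
  simpa using hmv

/-- uniform strict ellipticity of the scheme:
∂𝓕/∂s_y − (h|y|/2)|∂𝓕/∂q_y| ≥ α₀ implies a quantitative monotonicity bound,
and in particular the strict monotonicity condition (C5_1). -/
theorem FDop_uniformly_elliptic
    (n : ℕ) (hn : 1 ≤ n) (h : ℝ) (hh : 0 < h)
    (Y : Finset (Fin n → ℤ)) (hY0 : (0 : Fin n → ℤ) ∉ Y)
    (F : (Fin n → ℝ) → ℝ → (↥Y → ℝ) → (↥Y → ℝ) → ℝ)
    (hreg : ∀ x : Fin n → ℝ,
      ContDiff ℝ 1 (fun p : ℝ × (↥Y → ℝ) × (↥Y → ℝ) => F x p.1 p.2.1 p.2.2))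
    (α₀ : ℝ) (hα₀ : 0 < α₀)
    (hell : ∀ (x : Fin n → ℝ) (z : ℝ) (q s : ↥Y → ℝ) (y : ↥Y),
      deriv (fun t => F x z q (Function.update s y t)) (s y)
          - (h * ynorm (y : Fin n → ℤ) / 2) *
              |deriv (fun t => F x z (Function.update q y t) s) (q y)| ≥ α₀) :
    ∀ (x : Fin n → ℝ) (z : ℝ) (u η : (Fin n → ℝ) → ℝ),
      (∀ ξ : Fin n → ℝ, 0 ≤ η ξ) →
      (FDop h Y F x z (u + η) - FDop h Y F x z u ≥
        α₀ * ∑ y : ↥Y, (η (x + h • toR (y : Fin n → ℤ)) + η (x - h • toR (y : Fin n → ℤ)))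
            / (h ^ 2 * (ynorm (y : Fin n → ℤ)) ^ 2)) ∧
      ((∃ y : ↥Y, 0 < η (x + h • toR (y : Fin n → ℤ)) ∨
          0 < η (x - h • toR (y : Fin n → ℤ))) →
        FDop h Y F x z (u + η) > FDop h Y F x z u) := by
  intro x z u η hη
  have hpos (y : ↥Y) : 0 < ynorm (y : Fin n → ℤ) :=
    ynorm_pos fun hy => hY0 (hy ▸ y.2)
  set b : ↥Y → ℝ := fun y => (η (x + h • toR (y : Fin n → ℤ)) + η (x - h • toR (y : Fin n → ℤ)))
            / (h ^ 2 * (ynorm (y : Fin n → ℤ)) ^ 2) with hb_def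
  set a : ↥Y → ℝ := fun y => (η (x + h • toR (y : Fin n → ℤ)) - η (x - h • toR (y : Fin n → ℤ)))
            / (2 * h * ynorm (y : Fin n → ℤ)) with ha_def
  have hb (y : ↥Y) : 0 ≤ b y :=
    div_nonneg (add_nonneg (hη _) (hη _)) (by positivity)
  have hab (y : ↥Y) : |a y| ≤ h * ynorm (y : Fin n → ℤ) / 2 * b y := by
    have hy := hpos y
    have hrw : h * ynorm (y : Fin n → ℤ) / 2 * b y =
        (η (x + h • toR (y : Fin n → ℤ)) + η (x - h • toR (y : Fin n → ℤ)))
          / (2 * h * ynorm (y : Fin n → ℤ)) := by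
      simp only [hb_def]
      field_simp
    rw [hrw, ha_def, abs_div, abs_of_pos (by positivity : 0 < 2 * h * ynorm (y : Fin n → ℤ))]
    gcongr
    have h₁ := hη (x + h • toR (y : Fin n → ℤ))
    have h₂ := hη (x - h • toR (y : Fin n → ℤ))
    exact abs_le.mpr ⟨by linarith, by linarith⟩
  have hdiff : Differentiable ℝ (fun p : (↥Y → ℝ) × (↥Y → ℝ) => F x z p.1 p.2) :=
    ((hreg x).differentiable one_ne_zero).comp
      ((differentiable_const z).prodMk differentiable_id)
  have key : FDop h Y F x z (u + η) - FDop h Y F x z u ≥ α₀ * ∑ y, b y := by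
    have hmono := mul_sum_le_sub_of_partial_deriv_gap _ hdiff _ α₀ (fun q s y => hell x z q s y)
      (fun y => (u (x + h • toR (y : Fin n → ℤ)) - u (x - h • toR (y : Fin n → ℤ)))
        / (2 * h * ynorm (y : Fin n → ℤ)))
      (fun y => (u (x + h • toR (y : Fin n → ℤ)) + u (x - h • toR (y : Fin n → ℤ)) - 2 * z)
        / (h ^ 2 * (ynorm (y : Fin n → ℤ)) ^ 2)) a b hb hab
    refine ge_iff_le.mpr (hmono.trans_eq ?_)
    unfold FDop
    congr 2 <;> ext y <;> simp only [Pi.add_apply, ha_def, hb_def] <;> ring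
  refine ⟨key, fun ⟨y, hy⟩ => ?_⟩
  have hby : 0 < b y := by
    have hn := hpos y
    refine div_pos ?_ (by positivity)
    rcases hy with hy | hy
    · exact add_pos_of_pos_of_nonneg hy (hη _)
    · exact add_pos_of_nonneg_of_pos (hη _) hy
  have hsum : 0 < ∑ y, b y := Finset.sum_pos' (fun y _ => hb y) ⟨y, Finset.mem_univ y, hby⟩
  linarith [mul_pos hα₀ hsum]
end

section
/- There exist λ_{1,h} ∈ ℝ and an admissible function w : hℤⁿ → ℝ with w(x) > 0 for all x ∈ Ω_h such that L_h w(x) + λ_{1,h} w(x) = 0 for all x ∈ Ω_h. Moreover λ_{1,h} is a simple eigenvalue: the real vector space of admissible functions v satisfying L_h v(x) + λ_{1,h} v(x) = 0 for all x ∈ Ω_h is one-dimensional. -/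
/-- The linear finite difference scheme L_h on the lattice hℤⁿ, with lattice points
identified with their integer coordinates: the lattice point h·x corresponds to x ∈ ℤⁿ,
and h·x ± h·y_k corresponds to x ± y_k. -/
noncomputable def Lh {n K : ℕ} (h : ℝ) (Y : Fin K → (Fin n → ℤ))
    (abar bbar : Fin K → (Fin n → ℤ) → ℝ) (cbar : (Fin n → ℤ) → ℝ)
    (u : (Fin n → ℤ) → ℝ) (x : Fin n → ℤ) : ℝ :=
  (∑ k, (abar k x * (u (x + Y k) + u (x - Y k) - 2 * u x) / (h ^ 2 * (ynorm (Y k)) ^ 2)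
      + bbar k x * (u (x + Y k) - u (x - Y k)) / (2 * h * ynorm (Y k))))
    + cbar x * u x

/-- Discrete connectedness of Ω_h: any two points are joined by a chain of points of Ω_h
whose consecutive terms differ by ± a canonical basis vector (i.e. by ±h·e_i in hℤⁿ). -/
def DiscretelyConnected {n : ℕ} (Ωh : Finset (Fin n → ℤ)) : Prop :=
  ∀ p ∈ Ωh, ∀ q ∈ Ωh,
    Relation.ReflTransGen
      (fun a b => b ∈ Ωh ∧ ∃ i : Fin n, b = a + Pi.single i 1 ∨ b = a - Pi.single i 1) p q

/-- A relation on `ι` through which a linear map spreads positivity: `T.SpreadsPos i j` says that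
`T v` is positive at `i` as soon as `v ≥ 0` is positive at `j`. -/
def LinearMap.SpreadsPos {ι : Type*} (T : (ι → ℝ) →ₗ[ℝ] (ι → ℝ)) (i j : ι) : Prop :=
  ∀ v : ι → ℝ, 0 ≤ v → 0 < v j → 0 < T v i

namespace PerronFrobenius

variable {ι : Type*} {T : (ι → ℝ) →ₗ[ℝ] (ι → ℝ)}

theorem pow_nonneg (hT : ∀ v, 0 ≤ v → 0 ≤ T v) (N : ℕ) {v : ι → ℝ} (hv : 0 ≤ v) :
    0 ≤ (T ^ N) v := by
  induction N with
  | zero => simpa using hv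
  | succ N ih =>
    rw [pow_succ', Module.End.mul_apply]
    exact hT _ ih

/-- An irreducible positive map with positive diagonal is eventually strictly positive. -/
theorem exists_pow_pos [Finite ι] (hT : ∀ v, 0 ≤ v → 0 ≤ T v)
    (hdiag : ∀ i, T.SpreadsPos i i)
    (hirr : ∀ i j, Relation.ReflTransGen T.SpreadsPos i j)
    {d : ι → ℝ} (hd : 0 ≤ d) (hd0 : d ≠ 0) : ∃ N : ℕ, ∀ i, 0 < (T ^ N) d i := by
  obtain ⟨j, hj⟩ := Function.ne_iff.mp hd0
  have hj : 0 < d j := lt_of_le_of_ne (hd j) (Ne.symm hj)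
  have key : ∀ i, ∀ᶠ N : ℕ in Filter.atTop, 0 < (T ^ N) d i := by
    intro i
    rw [Filter.eventually_atTop]
    induction hirr i j using Relation.ReflTransGen.head_induction_on with
    | refl =>
      refine ⟨0, fun N _ => ?_⟩
      induction N with
      | zero => simpa using hj
      | succ N ih =>
        rw [pow_succ', Module.End.mul_apply]
        exact hdiag j _ (pow_nonneg hT N hd) (ih (Nat.zero_le _))
    | head hab _ ih =>
      obtain ⟨N₀, hN₀⟩ := ih
      refine ⟨N₀ + 1, fun N hN => ?_⟩
      obtain ⟨m, rfl⟩ : ∃ m, N = m + 1 := ⟨N - 1, by omega⟩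
      rw [pow_succ', Module.End.mul_apply]
      exact hab _ (pow_nonneg hT m hd) (hN₀ m (by omega))
  exact (Filter.eventually_all.mpr key).exists

/-- A nonnegative eigenvector of an irreducible positive map that vanishes somewhere is zero. -/
theorem eq_zero_of_apply_eq_zero
    (hirr : ∀ i j, Relation.ReflTransGen T.SpreadsPos i j)
    {s : ℝ} {x : ι → ℝ} (hx : 0 ≤ x) (hTx : T x = s • x) {i : ι} (hi : x i = 0) : x = 0 := by
  funext j
  induction hirr i j with
  | refl => exact hi
  | tail _ hbc ih =>
    refine le_antisymm (not_lt.mp fun hc => ?_) (hx _)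
    have := hbc x hx hc
    rw [hTx, Pi.smul_apply, ih] at this
    simp at this

/-- If `T z < s z` strictly in every coordinate, then `s` can be lowered. -/
theorem exists_lt_apply_le [Fintype ι] [Nonempty ι] (hT : ∀ v, 0 ≤ v → 0 ≤ T v)
    {s : ℝ} (hs : 0 ≤ s) {z : ι → ℝ} (hz : 0 ≤ z) (hlt : ∀ i, T z i < s * z i) :
    (∀ i, 0 < z i) ∧ ∃ r : ℝ, 0 ≤ r ∧ r < s ∧ T z ≤ r • z := by
  have hpos : ∀ i, 0 < z i := fun i =>
    pos_of_mul_pos_right ((hT z hz i).trans_lt (hlt i)) hs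
  obtain ⟨i, -, hi⟩ := Finset.exists_max_image Finset.univ (fun i => T z i / z i)
    Finset.univ_nonempty
  refine ⟨hpos, T z i / z i, div_nonneg (hT z hz i) (hz i),
    (div_lt_iff₀ (hpos i)).mpr (hlt i), fun j => ?_⟩
  exact (div_le_iff₀ (hpos j)).mp (hi j (Finset.mem_univ j))

/-- The minimum of the Collatz-Wielandt bounds `s` with `T x ≤ s x` is attained. -/
theorem exists_isLeast_bound [Fintype ι] [Nonempty ι] (hT : ∀ v, 0 ≤ v → 0 ≤ T v) :
    ∃ s : ℝ, 0 ≤ s ∧ ∃ x ∈ stdSimplex ℝ ι, T x ≤ s • x ∧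
      ∀ y ∈ stdSimplex ℝ ι, ∀ r : ℝ, 0 ≤ r → T y ≤ r • y → s ≤ r := by
  have hTc : Continuous T := T.continuous_of_finiteDimensional
  have hcard : (0 : ℝ) < Fintype.card ι := by exact_mod_cast Fintype.card_pos
  let u : ι → ℝ := fun _ => (Fintype.card ι : ℝ)⁻¹
  have hupos : ∀ i, 0 < u i := fun i => inv_pos.mpr hcard
  have hu : u ∈ stdSimplex ℝ ι := ⟨fun i => (hupos i).le, by simp [u, hcard.ne']⟩
  obtain ⟨S, hS0, hS⟩ : ∃ S : ℝ, 0 ≤ S ∧ T u ≤ S • u := by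
    obtain ⟨i, -, hi⟩ := Finset.exists_max_image Finset.univ (fun i => T u i / u i)
      Finset.univ_nonempty
    exact ⟨T u i / u i, div_nonneg (hT u hu.1 i) (hupos i).le,
      fun j => (div_le_iff₀ (hupos j)).mp (hi j (Finset.mem_univ j))⟩
  let C : Set ((ι → ℝ) × ℝ) := (stdSimplex ℝ ι ×ˢ Set.Icc 0 S) ∩ {p | T p.1 ≤ p.2 • p.1}
  have hC : IsCompact C := ((isCompact_stdSimplex ℝ ι).prod isCompact_Icc).inter_right
    (isClosed_le (hTc.comp continuous_fst) (continuous_snd.smul continuous_fst))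
  obtain ⟨⟨x, s⟩, ⟨⟨hx, hs⟩, hxs⟩, hmin⟩ := hC.exists_isMinOn
    ⟨(u, S), ⟨⟨hu, hS0, le_rfl⟩, hS⟩⟩ continuous_snd.continuousOn
  refine ⟨s, hs.1, x, hx, hxs, fun y hy r hr hyr => ?_⟩
  by_cases hrS : r ≤ S
  · exact hmin (show (y, r) ∈ C from ⟨⟨hy, hr, hrS⟩, hyr⟩)
  · exact hs.2.trans (not_le.mp hrS).le

/-- Perron-Frobenius: an irreducible positive map with positive diagonal has a strictly positive
eigenvector, and the corresponding real eigenvalue is geometrically simple. -/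
theorem exists_pos_eigenvector [Fintype ι] [Nonempty ι] (hT : ∀ v, 0 ≤ v → 0 ≤ T v)
    (hdiag : ∀ i, T.SpreadsPos i i)
    (hirr : ∀ i j, Relation.ReflTransGen T.SpreadsPos i j) :
    ∃ (s : ℝ) (x : ι → ℝ), (∀ i, 0 < x i) ∧ T x = s • x ∧
      ∀ v, T v = s • v → ∃ c : ℝ, v = c • x := by
  obtain ⟨s, hs, x, hx, hxs, hmin⟩ := exists_isLeast_bound hT
  have hTx : T x = s • x := by
    by_contra hne
    obtain ⟨N, hN⟩ := exists_pow_pos hT hdiag hirr (sub_nonneg.mpr hxs)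
      (sub_ne_zero.mpr (Ne.symm hne))
    have hlt : ∀ i, T ((T ^ N) x) i < s * (T ^ N) x i := fun i => by
      have := hN i
      rw [map_sub, map_smul, ← Module.End.mul_apply, ← pow_succ, pow_succ',
        Module.End.mul_apply] at this
      simpa using this
    obtain ⟨hzpos, r, hr, hrs, hzr⟩ :=
      exists_lt_apply_le hT hs (pow_nonneg hT N hx.1) hlt
    set z := (T ^ N) x
    have hsum : 0 < ∑ i, z i := Finset.sum_pos (fun i _ => hzpos i) Finset.univ_nonempty
    refine hrs.not_ge (hmin ((∑ i, z i)⁻¹ • z) ⟨fun i => ?_, ?_⟩ r hr ?_)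
    · exact mul_nonneg (inv_nonneg.mpr hsum.le) (hzpos i).le
    · simp [← Finset.mul_sum, hsum.ne']
    · rw [map_smul, smul_comm r]
      exact smul_le_smul_of_nonneg_left hzr (inv_nonneg.mpr hsum.le)
  have hxpos : ∀ i, 0 < x i := fun i => by
    refine lt_of_le_of_ne (hx.1 i) fun h0 => ?_
    have h1 := hx.2
    rw [eq_zero_of_apply_eq_zero hirr hx.1 hTx h0.symm] at h1
    simp at h1
  refine ⟨s, x, hxpos, hTx, fun v hv => ?_⟩
  obtain ⟨i, -, hi⟩ := Finset.exists_min_image Finset.univ (fun i => v i / x i)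
    Finset.univ_nonempty
  refine ⟨v i / x i, sub_eq_zero.mp (eq_zero_of_apply_eq_zero hirr (s := s) (i := i) ?_ ?_ ?_)⟩
  · intro j
    have := (le_div_iff₀ (hxpos j)).mp (hi j (Finset.mem_univ j))
    simpa using this
  · rw [map_sub, map_smul, hv, hTx, smul_sub, smul_comm s]
  · simp [(hxpos i).ne']

end PerronFrobenius

theorem ynorm_nonneg {n : ℕ} (y : Fin n → ℤ) : 0 ≤ ynorm y := Real.sqrt_nonneg _

/-- The scheme written as a weighted sum of neighbouring values minus a diagonal term. -/
theorem Lh_eq {n K : ℕ} (h : ℝ) (Y : Fin K → (Fin n → ℤ))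
    (abar bbar : Fin K → (Fin n → ℤ) → ℝ) (cbar : (Fin n → ℤ) → ℝ)
    (u : (Fin n → ℤ) → ℝ) (x : Fin n → ℤ) :
    Lh h Y abar bbar cbar u x =
      ∑ k, ((abar k x / (h ^ 2 * ynorm (Y k) ^ 2) + bbar k x / (2 * h * ynorm (Y k))) *
          u (x + Y k) +
        (abar k x / (h ^ 2 * ynorm (Y k) ^ 2) - bbar k x / (2 * h * ynorm (Y k))) *
          u (x - Y k)) -
      (∑ k, 2 * (abar k x / (h ^ 2 * ynorm (Y k) ^ 2)) - cbar x) * u x := by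
  rw [Lh, sub_mul, sub_sub_eq_add_sub, add_sub_right_comm, Finset.sum_mul,
    ← Finset.sum_sub_distrib]
  congr 1
  exact Finset.sum_congr rfl fun k _ => by ring

open Classical in
/-- Extension by zero of a function on a finite set of lattice points. -/
noncomputable def extendZero {α : Type*} (s : Finset α) (v : s → ℝ) (x : α) : ℝ :=
  if hx : x ∈ s then v ⟨x, hx⟩ else 0

section extendZero

variable {α : Type*} {s : Finset α}

theorem extendZero_coe (v : s → ℝ) (x : s) : extendZero s v x = v x := by
  simp [extendZero]

theorem extendZero_of_notMem (v : s → ℝ) {x : α} (hx : x ∉ s) : extendZero s v x = 0 := by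
  simp [extendZero, hx]

theorem extendZero_nonneg {v : s → ℝ} (hv : 0 ≤ v) (x : α) : 0 ≤ extendZero s v x := by
  unfold extendZero
  split_ifs
  exacts [hv _, le_rfl]

theorem extendZero_add (v w : s → ℝ) (x : α) :
    extendZero s (v + w) x = extendZero s v x + extendZero s w x := by
  by_cases hx : x ∈ s <;> simp [extendZero, hx]

theorem extendZero_smul (c : ℝ) (v : s → ℝ) (x : α) :
    extendZero s (c • v) x = c * extendZero s v x := by
  by_cases hx : x ∈ s <;> simp [extendZero, hx]

theorem extendZero_restrict {v : α → ℝ} (hv : ∀ x ∉ s, v x = 0) :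
    extendZero s (fun x => v x) = v := by
  funext x
  by_cases hx : x ∈ s <;> simp [extendZero, hx, hv]

end extendZero

/-- The shifted scheme `L_h + t` as a linear map on functions on `Ω_h` extended by zero. -/
noncomputable def shiftedLh {n K : ℕ} (h : ℝ) (Y : Fin K → (Fin n → ℤ))
    (abar bbar : Fin K → (Fin n → ℤ) → ℝ) (cbar : (Fin n → ℤ) → ℝ)
    (Ωh : Finset (Fin n → ℤ)) (t : ℝ) : (Ωh → ℝ) →ₗ[ℝ] (Ωh → ℝ) where
  toFun v x := Lh h Y abar bbar cbar (extendZero Ωh v) x + t * v x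
  map_add' v w := by
    funext x
    simp only [Lh_eq, extendZero_add, Pi.add_apply, mul_add, Finset.sum_add_distrib]
    ring
  map_smul' c v := by
    funext x
    simp only [Lh_eq, extendZero_smul, Pi.smul_apply, smul_eq_mul, RingHom.id_apply,
      mul_left_comm _ c, ← mul_add, ← Finset.mul_sum]
    ring

/-- existence of a discrete principal eigenvalue with positive eigenfunction,
and simplicity: every admissible solution of the same equation is a multiple of it. -/
theorem discrete_principal_eigenvalue_exists_simple
    (n K : ℕ) (hn : 1 ≤ n) (hK : 1 ≤ K) (h : ℝ) (hh : 0 < h)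
    (Y : Fin K → (Fin n → ℤ)) (hY0 : ∀ k, Y k ≠ 0)
    (hYbasis : ∀ i : Fin n, ∃ k, Y k = Pi.single i 1)
    (Ωh : Finset (Fin n → ℤ)) (hΩne : Ωh.Nonempty)
    (hconn : DiscretelyConnected Ωh)
    (abar bbar : Fin K → (Fin n → ℤ) → ℝ) (cbar : (Fin n → ℤ) → ℝ)
    (hell : ∀ x ∈ Ωh, ∀ k,
      0 < abar k x / (h ^ 2 * (ynorm (Y k)) ^ 2) - |bbar k x| / (2 * h * ynorm (Y k)))
    (hc : ∀ x ∈ Ωh, cbar x ≤ 0) :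
    ∃ (lam : ℝ) (w : (Fin n → ℤ) → ℝ),
      (∀ x ∉ Ωh, w x = 0) ∧ (∀ x ∈ Ωh, 0 < w x) ∧
      (∀ x ∈ Ωh, Lh h Y abar bbar cbar w x + lam * w x = 0) ∧
      (∀ v : (Fin n → ℤ) → ℝ, (∀ x ∉ Ωh, v x = 0) →
        (∀ x ∈ Ωh, Lh h Y abar bbar cbar v x + lam * v x = 0) →
        ∃ c : ℝ, v = c • w) := by
  have hα : ∀ x ∈ Ωh, ∀ k,
      0 < abar k x / (h ^ 2 * ynorm (Y k) ^ 2) + bbar k x / (2 * h * ynorm (Y k)) ∧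
      0 < abar k x / (h ^ 2 * ynorm (Y k) ^ 2) - bbar k x / (2 * h * ynorm (Y k)) := by
    intro x hx k
    have h1 := hell x hx k
    have h2 : 0 ≤ 2 * h * ynorm (Y k) := mul_nonneg (by positivity) (ynorm_nonneg _)
    rw [← abs_of_nonneg h2, ← abs_div] at h1
    have h3 := le_abs_self (bbar k x / (2 * h * ynorm (Y k)))
    have h4 := neg_abs_le (bbar k x / (2 * h * ynorm (Y k)))
    constructor <;> linarith
  let D : (Fin n → ℤ) → ℝ := fun x =>
    ∑ k, 2 * (abar k x / (h ^ 2 * ynorm (Y k) ^ 2)) - cbar x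
  obtain ⟨t, ht⟩ : ∃ t, ∀ x ∈ Ωh, D x < t := by
    obtain ⟨p, -, hp⟩ := Finset.exists_max_image Ωh D hΩne
    exact ⟨D p + 1, fun x hx => (hp x hx).trans_lt (lt_add_one _)⟩
  let T := shiftedLh h Y abar bbar cbar Ωh t
  let S : (Ωh → ℝ) → Ωh → Fin K → ℝ := fun v x k =>
    (abar k x / (h ^ 2 * ynorm (Y k) ^ 2) + bbar k x / (2 * h * ynorm (Y k))) *
        extendZero Ωh v (x + Y k) +
      (abar k x / (h ^ 2 * ynorm (Y k) ^ 2) - bbar k x / (2 * h * ynorm (Y k))) *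
        extendZero Ωh v (x - Y k)
  have hTeq : ∀ v x, T v x = ∑ k, S v x k + (t - D x) * v x := by
    intro v x
    change Lh h Y abar bbar cbar (extendZero Ωh v) x + t * v x = _
    rw [Lh_eq, extendZero_coe]
    ring
  have hS : ∀ v, 0 ≤ v → ∀ x k, 0 ≤ S v x k := fun v hv x k =>
    add_nonneg (mul_nonneg (hα x x.2 k).1.le (extendZero_nonneg hv _))
      (mul_nonneg (hα x x.2 k).2.le (extendZero_nonneg hv _))
  have hdiagterm : ∀ v : Ωh → ℝ, 0 ≤ v → ∀ x : Ωh, 0 ≤ (t - D x) * v x := fun v hv x =>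
    mul_nonneg (sub_pos.mpr (ht x x.2)).le (hv x)
  have hT : ∀ v, 0 ≤ v → 0 ≤ T v := fun v hv x => by
    rw [hTeq]
    exact add_nonneg (Finset.sum_nonneg fun k _ => hS v hv x k) (hdiagterm v hv x)
  have hdiag : ∀ x, T.SpreadsPos x x := fun x v hv hvx => by
    rw [hTeq]
    exact add_pos_of_nonneg_of_pos (Finset.sum_nonneg fun k _ => hS v hv x k)
      (mul_pos (sub_pos.mpr (ht x x.2)) hvx)
  have hnbr : ∀ (x y : Ωh) (i : Fin n),
      y.1 = x.1 + Pi.single i 1 ∨ y.1 = x.1 - Pi.single i 1 →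
      T.SpreadsPos x y := by
    intro x y i hxy v hv hvy
    obtain ⟨k, hk⟩ := hYbasis i
    rw [← hk] at hxy
    rw [← extendZero_coe v y] at hvy
    have hSk : 0 < S v x k := by
      rcases hxy with hxy | hxy
      · rw [hxy] at hvy
        exact add_pos_of_pos_of_nonneg (mul_pos (hα x x.2 k).1 hvy)
          (mul_nonneg (hα x x.2 k).2.le (extendZero_nonneg hv _))
      · rw [hxy] at hvy
        exact add_pos_of_nonneg_of_pos
          (mul_nonneg (hα x x.2 k).1.le (extendZero_nonneg hv _)) (mul_pos (hα x x.2 k).2 hvy)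
    rw [hTeq]
    exact add_pos_of_pos_of_nonneg
      (Finset.sum_pos' (fun k _ => hS v hv x k) ⟨k, Finset.mem_univ k, hSk⟩) (hdiagterm v hv x)
  have hirr : ∀ p q, Relation.ReflTransGen T.SpreadsPos p q := by
    rintro ⟨p, hp⟩ ⟨q, hq⟩
    have hpq := hconn p hp q hq
    have key : ∃ hq' : q ∈ Ωh, Relation.ReflTransGen T.SpreadsPos ⟨p, hp⟩ ⟨q, hq'⟩ := by
      clear hq
      induction hpq with
      | refl => exact ⟨hp, .refl⟩
      | tail _ hbc ih =>
        obtain ⟨hb, ih⟩ := ih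
        obtain ⟨hc', i, hi⟩ := hbc
        exact ⟨hc', ih.tail (hnbr ⟨_, hb⟩ ⟨_, hc'⟩ i hi)⟩
    exact key.2
  have : Nonempty Ωh := hΩne.to_subtype
  obtain ⟨s, w, hwpos, hw, hsimple⟩ := PerronFrobenius.exists_pos_eigenvector hT hdiag hirr
  refine ⟨t - s, extendZero Ωh w, fun x hx => extendZero_of_notMem w hx, fun x hx => ?_,
    fun x hx => ?_, fun v hv0 hv => ?_⟩
  · exact (hwpos ⟨x, hx⟩).trans_eq (extendZero_coe w ⟨x, hx⟩).symm
  · have h1 : Lh h Y abar bbar cbar (extendZero Ωh w) x + t * w ⟨x, hx⟩ = s * w ⟨x, hx⟩ :=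
      congrFun hw ⟨x, hx⟩
    have h2 : extendZero Ωh w x = w ⟨x, hx⟩ := extendZero_coe w ⟨x, hx⟩
    rw [h2]
    linarith
  · obtain ⟨c, hc'⟩ := hsimple (fun x => v x) (by
      funext x
      change Lh h Y abar bbar cbar (extendZero Ωh fun x => v x) x + t * v x = s * v x
      rw [extendZero_restrict hv0]
      linarith [hv x x.2])
    refine ⟨c, ?_⟩
    rw [← extendZero_restrict hv0, hc']
    funext x
    exact extendZero_smul c w x
end

section
/- Suppose λ* ∈ ℝ and w is an admissible function with w(x) > 0 for all x ∈ Ω_h and L_h w(x) + λ* w(x) = 0 for all x ∈ Ω_h. Then λ* = sup { λ ∈ ℝ : there exists u : hℤⁿ → ℝ with u ≥ 0 everywhere, u(x) > 0 for all x ∈ Ω_h, and L_h u(x) + λ u(x) ≤ 0 for all x ∈ Ω_h }. -/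
/-- At a zero of a nonnegative lattice function, a monotone scheme takes a nonnegative value. -/
theorem Lh_nonneg_of_nonneg_of_eq_zero {n K : ℕ} {h : ℝ} {Y : Fin K → (Fin n → ℤ)}
    {abar bbar : Fin K → (Fin n → ℤ) → ℝ} {cbar : (Fin n → ℤ) → ℝ}
    {z : (Fin n → ℤ) → ℝ} {x : Fin n → ℤ} (hh : 0 ≤ h)
    (hell : ∀ k, 0 ≤ abar k x / (h ^ 2 * (ynorm (Y k)) ^ 2)
      - |bbar k x| / (2 * h * ynorm (Y k)))
    (hz : ∀ ξ, 0 ≤ z ξ) (hzx : z x = 0) :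
    0 ≤ Lh h Y abar bbar cbar z x := by
  unfold Lh
  simp only [hzx, mul_zero, add_zero, sub_zero]
  refine Finset.sum_nonneg fun k _ => ?_
  have hden : 0 ≤ 2 * h * ynorm (Y k) := mul_nonneg (by positivity) (Real.sqrt_nonneg _)
  have habs : |bbar k x / (2 * h * ynorm (Y k))| = |bbar k x| / (2 * h * ynorm (Y k)) := by
    rw [abs_div, abs_of_nonneg hden]
  have hk := hell k
  rw [← habs] at hk
  have hplus := mul_nonneg
    (show 0 ≤ abar k x / (h ^ 2 * (ynorm (Y k)) ^ 2) + bbar k x / (2 * h * ynorm (Y k)) by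
      linarith [neg_abs_le (bbar k x / (2 * h * ynorm (Y k)))]) (hz (x + Y k))
  have hminus := mul_nonneg
    (show 0 ≤ abar k x / (h ^ 2 * (ynorm (Y k)) ^ 2) - bbar k x / (2 * h * ynorm (Y k)) by
      linarith [le_abs_self (bbar k x / (2 * h * ynorm (Y k)))]) (hz (x - Y k))
  rw [mul_div_right_comm, mul_div_right_comm (bbar k x)]
  linarith

theorem Lh_sub_const_mul {n K : ℕ} (h : ℝ) (Y : Fin K → (Fin n → ℤ))
    (abar bbar : Fin K → (Fin n → ℤ) → ℝ) (cbar : (Fin n → ℤ) → ℝ)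
    (u w : (Fin n → ℤ) → ℝ) (t : ℝ) (x : Fin n → ℤ) :
    Lh h Y abar bbar cbar (fun ξ => u ξ - t * w ξ) x
      = Lh h Y abar bbar cbar u x - t * Lh h Y abar bbar cbar w x := by
  unfold Lh
  rw [mul_add, Finset.mul_sum, add_sub_add_comm, ← Finset.sum_sub_distrib]
  congr 1
  · exact Finset.sum_congr rfl fun k _ => by ring
  · ring

/-- characterization of the discrete principal eigenvalue as the supremum of
λ admitting a positive supersolution. -/
theorem discrete_principal_eigenvalue_sup_characterization
    (n K : ℕ) (hn : 1 ≤ n) (hK : 1 ≤ K) (h : ℝ) (hh : 0 < h)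
    (Y : Fin K → (Fin n → ℤ)) (hY0 : ∀ k, Y k ≠ 0)
    (hYbasis : ∀ i : Fin n, ∃ k, Y k = Pi.single i 1)
    (Ωh : Finset (Fin n → ℤ)) (hΩne : Ωh.Nonempty)
    (hconn : DiscretelyConnected Ωh)
    (abar bbar : Fin K → (Fin n → ℤ) → ℝ) (cbar : (Fin n → ℤ) → ℝ)
    (hell : ∀ x ∈ Ωh, ∀ k,
      0 < abar k x / (h ^ 2 * (ynorm (Y k)) ^ 2) - |bbar k x| / (2 * h * ynorm (Y k)))
    (hc : ∀ x ∈ Ωh, cbar x ≤ 0)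
    (lamStar : ℝ) (w : (Fin n → ℤ) → ℝ)
    (hwadm : ∀ x ∉ Ωh, w x = 0) (hwpos : ∀ x ∈ Ωh, 0 < w x)
    (hweig : ∀ x ∈ Ωh, Lh h Y abar bbar cbar w x + lamStar * w x = 0) :
    lamStar = sSup {lam : ℝ | ∃ u : (Fin n → ℤ) → ℝ,
      (∀ ξ, 0 ≤ u ξ) ∧ (∀ x ∈ Ωh, 0 < u x) ∧
      ∀ x ∈ Ωh, Lh h Y abar bbar cbar u x + lam * u x ≤ 0} := by
  symm
  refine IsGreatest.csSup_eq ⟨⟨w, fun ξ => ?_, hwpos, fun x hx => (hweig x hx).le⟩, ?_⟩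
  · by_cases hξ : ξ ∈ Ωh
    · exact (hwpos ξ hξ).le
    · exact (hwadm ξ hξ).ge
  rintro lam ⟨u, hu0, hupos, hu⟩
  obtain ⟨x, hx, hmin⟩ := Ωh.exists_min_image (fun ξ => u ξ / w ξ) hΩne
  have hux : u x / w x * w x = u x := div_mul_cancel₀ _ (hwpos x hx).ne'
  have hL : 0 ≤ Lh h Y abar bbar cbar (fun ξ => u ξ - u x / w x * w ξ) x := by
    refine Lh_nonneg_of_nonneg_of_eq_zero hh.le (fun k => (hell x hx k).le) (fun ξ => ?_) ?_
    · by_cases hξ : ξ ∈ Ωh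
      · exact sub_nonneg.2 ((le_div_iff₀ (hwpos ξ hξ)).1 (hmin ξ hξ))
      · simpa [hwadm ξ hξ] using hu0 ξ
    · exact sub_eq_zero.2 hux.symm
  rw [Lh_sub_const_mul, eq_neg_of_add_eq_zero_left (hweig x hx), mul_neg, mul_left_comm, hux] at hL
  refine le_of_mul_le_mul_right ?_ (hupos x hx)
  linarith [hu x hx]
end

section
/- Suppose λ* ∈ ℝ and w is an admissible function with w(x) > 0 for all x ∈ Ω_h and L_h w(x) + λ* w(x) = 0 for all x ∈ Ω_h. Then λ* = − inf { max_{x ∈ Ω_h} L_h φ(x)/φ(x) : φ an admissible function with φ(x) > 0 for all x ∈ Ω_h }. -/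
/-- Discrete comparison at a touching point: under the ellipticity condition at `x`, if `u ≤ v`
with equality at `x`, then `L_h u x ≤ L_h v x`. -/
theorem Lh_le_Lh_of_touching {n K : ℕ} {h : ℝ} (hh : 0 < h) {Y : Fin K → (Fin n → ℤ)}
    {abar bbar : Fin K → (Fin n → ℤ) → ℝ} {cbar : (Fin n → ℤ) → ℝ} {x : Fin n → ℤ}
    (hell : ∀ k,
      0 < abar k x / (h ^ 2 * (ynorm (Y k)) ^ 2) - |bbar k x| / (2 * h * ynorm (Y k)))
    {u v : (Fin n → ℤ) → ℝ} (huv : ∀ y, u y ≤ v y) (hx : u x = v x) :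
    Lh h Y abar bbar cbar u x ≤ Lh h Y abar bbar cbar v x := by
  unfold Lh
  rw [hx]
  gcongr ?_ + _
  refine Finset.sum_le_sum fun k _ => ?_
  have hnonneg : 0 ≤ 2 * h * ynorm (Y k) :=
    mul_nonneg (by positivity) (Real.sqrt_nonneg _)
  have hk := hell k
  have habs : |bbar k x| / (2 * h * ynorm (Y k)) = |bbar k x / (2 * h * ynorm (Y k))| := by
    rw [abs_div, abs_of_nonneg hnonneg]
  rw [habs] at hk
  simp only [mul_div_right_comm (abar k x), mul_div_right_comm (bbar k x)]
  set a := abar k x / (h ^ 2 * (ynorm (Y k)) ^ 2)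
  set b := bbar k x / (2 * h * ynorm (Y k))
  have hplus : 0 ≤ a + b := by linarith [neg_abs_le b]
  have hminus : 0 ≤ a - b := by linarith [le_abs_self b]
  linarith [mul_le_mul_of_nonneg_left (huv (x + Y k)) hplus,
    mul_le_mul_of_nonneg_left (huv (x - Y k)) hminus]

/-- The scheme `L_h` is homogeneous. -/
theorem Lh_const_mul {n K : ℕ} (h : ℝ) (Y : Fin K → (Fin n → ℤ))
    (abar bbar : Fin K → (Fin n → ℤ) → ℝ) (cbar : (Fin n → ℤ) → ℝ) (t : ℝ)
    (u : (Fin n → ℤ) → ℝ) (x : Fin n → ℤ) :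
    Lh h Y abar bbar cbar (fun y => t * u y) x = t * Lh h Y abar bbar cbar u x := by
  simp only [Lh, mul_add, Finset.mul_sum]
  congr 1
  · exact Finset.sum_congr rfl fun k _ => by ring
  · ring

/-- inf-sup (min-max) characterization of the discrete principal eigenvalue. -/
theorem discrete_principal_eigenvalue_infsup_characterization
    (n K : ℕ) (hn : 1 ≤ n) (hK : 1 ≤ K) (h : ℝ) (hh : 0 < h)
    (Y : Fin K → (Fin n → ℤ)) (hY0 : ∀ k, Y k ≠ 0)
    (hYbasis : ∀ i : Fin n, ∃ k, Y k = Pi.single i 1)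
    (Ωh : Finset (Fin n → ℤ)) (hΩne : Ωh.Nonempty)
    (hconn : DiscretelyConnected Ωh)
    (abar bbar : Fin K → (Fin n → ℤ) → ℝ) (cbar : (Fin n → ℤ) → ℝ)
    (hell : ∀ x ∈ Ωh, ∀ k,
      0 < abar k x / (h ^ 2 * (ynorm (Y k)) ^ 2) - |bbar k x| / (2 * h * ynorm (Y k)))
    (hc : ∀ x ∈ Ωh, cbar x ≤ 0)
    (lamStar : ℝ) (w : (Fin n → ℤ) → ℝ)
    (hwadm : ∀ x ∉ Ωh, w x = 0) (hwpos : ∀ x ∈ Ωh, 0 < w x)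
    (hweig : ∀ x ∈ Ωh, Lh h Y abar bbar cbar w x + lamStar * w x = 0) :
    lamStar = - sInf {m : ℝ | ∃ φ : (Fin n → ℤ) → ℝ,
      (∀ x ∉ Ωh, φ x = 0) ∧ (∀ x ∈ Ωh, 0 < φ x) ∧
      m = Ωh.sup' hΩne (fun x => Lh h Y abar bbar cbar φ x / φ x)} := by
  rw [eq_neg_iff_add_eq_zero, add_comm, ← eq_neg_iff_add_eq_zero]
  refine IsLeast.csInf_eq ⟨⟨w, hwadm, hwpos, ?_⟩, ?_⟩
  · rw [Finset.sup'_congr hΩne rfl (g := fun _ => -lamStar), Finset.sup'_const]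
    intro x hx
    rw [div_eq_iff (hwpos x hx).ne']
    linarith [hweig x hx]
  · rintro m ⟨φ, hφadm, hφpos, rfl⟩
    obtain ⟨x, hx, hmin⟩ := Ωh.exists_min_image (fun y => φ y / w y) hΩne
    have htouch : φ x / w x * w x = φ x := div_mul_cancel₀ _ (hwpos x hx).ne'
    have hle : ∀ y, φ x / w x * w y ≤ φ y := by
      intro y
      by_cases hy : y ∈ Ωh
      · exact (le_div_iff₀ (hwpos y hy)).1 (hmin y hy)
      · simp [hwadm y hy, hφadm y hy]
    have hcomp := Lh_le_Lh_of_touching (cbar := cbar) hh (hell x hx) hle htouch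
    rw [Lh_const_mul, eq_neg_of_add_eq_zero_left (hweig x hx)] at hcomp
    refine le_trans ?_ (Finset.le_sup' (fun x => Lh h Y abar bbar cbar φ x / φ x) hx)
    rw [le_div_iff₀ (hφpos x hx)]
    calc -lamStar * φ x = φ x / w x * -(lamStar * w x) := by linear_combination lamStar * htouch
      _ ≤ _ := hcomp
end

section
/- For all γ₀, Γ₀, β > 0 there exists C > 0, depending only on γ₀, Γ₀ and β, with the following property. Let h > 0 and let N ≥ 1 be an integer with r := Nh ≤ 1; define the mesh function σ_i := (r² − (ih)²)² for i ∈ ℤ. If the coefficients satisfy γ₀ ≤ a_i ≤ Γ₀, |b_i| ≤ β and |c_i| ≤ β for all i with |i| ≤ N−1, then −L_h σ(i) ≤ (C/r²)·σ_i for every i with |i| ≤ N−1. -/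
/-- The one-dimensional linear finite difference scheme. -/
noncomputable def Lh1 (h : ℝ) (a b c : ℤ → ℝ) (U : ℤ → ℝ) (i : ℤ) : ℝ :=
  a i * (U (i + 1) + U (i - 1) - 2 * U i) / h ^ 2
    + b i * (U (i + 1) - U (i - 1)) / (2 * h) + c i * U i

/-- The scheme applied to the barrier `(R - x²)²` at `x = i h`, in closed form. -/
lemma Lh1_barrier {h : ℝ} (hh : h ≠ 0) (a b c : ℤ → ℝ) (R : ℝ) (i : ℤ) :
    Lh1 h a b c (fun j => (R - ((j : ℝ) * h) ^ 2) ^ 2) i =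
      a i * (8 * (i * h) ^ 2 - 4 * (R - (i * h) ^ 2) + 2 * h ^ 2)
        - 4 * b i * (i * h) * (R - (i * h) ^ 2 - h ^ 2) + c i * (R - (i * h) ^ 2) ^ 2 := by
  simp only [Lh1]
  push_cast
  field_simp
  ring

lemma barrier_pointwise_bound {γ Γ β a b c h x s R : ℝ} (hγ : 0 < γ) (hβ : 0 < β)
    (haγ : γ ≤ a) (haΓ : a ≤ Γ) (hb : |b| ≤ β) (hc : |c| ≤ β)
    (hR : 0 < R) (hR1 : R ≤ 1) (hs : h ^ 2 ≤ s) (hx : x ^ 2 = R - s) :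
    -(a * (8 * x ^ 2 - 4 * s + 2 * h ^ 2) - 4 * b * x * (s - h ^ 2) + c * s ^ 2)
      ≤ ((4 * Γ + β ^ 2 / γ + β) / R) * s ^ 2 := by
  have ha : 0 < a := hγ.trans_le haγ
  have hh : 0 ≤ h ^ 2 := sq_nonneg h
  have hs0 : 0 ≤ s := hh.trans hs
  have hq_sq : s ^ 2 ≤ s ^ 2 / R := le_div_self (sq_nonneg s) hR hR1
  have hq_lin : 2 * s - R ≤ s ^ 2 / R := by
    rw [le_div_iff₀ hR]
    nlinarith [sq_nonneg (s - R)]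
  have hq : 0 ≤ s ^ 2 / R := by positivity
  have hdiff : a * (4 * s - 4 * x ^ 2 - 2 * h ^ 2) ≤ 4 * Γ * (s ^ 2 / R) := by
    calc a * (4 * s - 4 * x ^ 2 - 2 * h ^ 2) ≤ a * (4 * (s ^ 2 / R)) :=
          mul_le_mul_of_nonneg_left (by linarith) ha.le
      _ ≤ Γ * (4 * (s ^ 2 / R)) := by gcongr
      _ = 4 * Γ * (s ^ 2 / R) := by ring
  have hdrift_abs : b * x * (s - h ^ 2) ≤ β * |x| * s := by
    calc b * x * (s - h ^ 2) ≤ |b * x * (s - h ^ 2)| := le_abs_self _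
      _ = |b| * |x| * (s - h ^ 2) := by
          rw [abs_mul, abs_mul, abs_of_nonneg (sub_nonneg.2 hs)]
      _ ≤ β * |x| * s := by gcongr; linarith
  have hyoung : 4 * (β * |x| * s) ≤ 4 * γ * x ^ 2 + β ^ 2 / γ * s ^ 2 := by
    have h0 : 0 ≤ (2 * γ * |x| - β * s) ^ 2 / γ := by positivity
    have h1 : (2 * γ * |x| - β * s) ^ 2 / γ
        = 4 * γ * |x| ^ 2 - 4 * (β * |x| * s) + β ^ 2 / γ * s ^ 2 := by
      field_simp
      ring
    rw [h1, sq_abs] at h0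
    linarith
  have hγa : γ * x ^ 2 ≤ a * x ^ 2 := by gcongr
  have hzero : -(c * s ^ 2) ≤ β * s ^ 2 := by
    rw [← neg_mul]
    gcongr
    exact (neg_le_abs c).trans hc
  have hβq : β * s ^ 2 ≤ β * (s ^ 2 / R) := by gcongr
  have hβγq : β ^ 2 / γ * s ^ 2 ≤ β ^ 2 / γ * (s ^ 2 / R) := by gcongr
  have hsplit : (4 * Γ + β ^ 2 / γ + β) / R * s ^ 2
      = 4 * Γ * (s ^ 2 / R) + β ^ 2 / γ * (s ^ 2 / R) + β * (s ^ 2 / R) := by ring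
  rw [hsplit]
  linarith

/-- the barrier σ_i = (r² − (ih)²)² satisfies −L_h σ(i) ≤ (C/r²)·σ_i,
with C depending only on the bounds γ₀, Γ₀, β on the coefficients. -/
theorem barrier_estimate_one_dim
    (γ₀ Γ₀ β : ℝ) (hγ : 0 < γ₀) (hΓ : 0 < Γ₀) (hβ : 0 < β) :
    ∃ C : ℝ, 0 < C ∧
      ∀ (h : ℝ) (N : ℕ) (a b c : ℤ → ℝ), 0 < h → 1 ≤ N → (N : ℝ) * h ≤ 1 →
        (∀ i : ℤ, |i| ≤ (N : ℤ) - 1 →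
          γ₀ ≤ a i ∧ a i ≤ Γ₀ ∧ |b i| ≤ β ∧ |c i| ≤ β) →
        ∀ i : ℤ, |i| ≤ (N : ℤ) - 1 →
          -(Lh1 h a b c (fun j => (((N : ℝ) * h) ^ 2 - ((j : ℝ) * h) ^ 2) ^ 2) i)
            ≤ (C / ((N : ℝ) * h) ^ 2) * (((N : ℝ) * h) ^ 2 - ((i : ℝ) * h) ^ 2) ^ 2 := by
  refine ⟨4 * Γ₀ + β ^ 2 / γ₀ + β, by positivity, ?_⟩
  intro h N a b c hh hN hr hcoef i hi
  obtain ⟨haγ, haΓ, hb, hc⟩ := hcoef i hi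
  have hN0 : (0 : ℝ) < N := by exact_mod_cast hN
  have hgap : i ^ 2 + 1 ≤ (N : ℤ) ^ 2 := by
    obtain ⟨h1, h2⟩ := abs_le.1 hi
    nlinarith
  have hgapR : (i : ℝ) ^ 2 + 1 ≤ (N : ℝ) ^ 2 := by exact_mod_cast hgap
  rw [Lh1_barrier hh.ne']
  refine barrier_pointwise_bound hγ hβ haγ haΓ hb hc (by positivity)
    (pow_le_one₀ (by positivity) hr) ?_ (by ring)
  nlinarith [mul_le_mul_of_nonneg_right hgapR (sq_nonneg h)]
end

section
/- Let F_h be a discrete operator of positive type which is positively homogeneous. Let B ⊆ Ω_h, let σ be a mesh function with σ(x₀) > 0 for some x₀ ∈ B and σ(y) ≤ 0 for all y ∈ Ω̄_h ∖ B, and let τ ∈ ℝ satisfy F_h(x,σ(x),σ) + τσ(x) ≥ 0 for all x ∈ B. If λ ∈ ℝ is such that there exists a mesh function φ with φ ≥ 0 on Ω̄_h, φ > 0 on Ω_h and F_h[φ](x) + λφ(x) ≤ 0 for all x ∈ Ω_h, then λ ≤ τ. -/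
/-- If σ is a mesh function, positive at some point of B ⊆ Ω_h,
nonpositive outside B, and satisfies F_h[σ] + τσ ≥ 0 on B, then any λ admitting
a positive supersolution φ with F_h[φ] + λφ ≤ 0 in Ω_h satisfies λ ≤ τ. -/
theorem eigenvalue_upper_bound_test_function
    {α : Type*} [DecidableEq α] (Ωh bΩh : Finset α)
    (hdisj : Disjoint Ωh bΩh) (hΩne : Ωh.Nonempty) (hbΩne : bΩh.Nonempty)
    (Fh : α → ℝ → (α → ℝ) → ℝ)
    (hloc : ∀ x ∈ Ωh, ∀ (z : ℝ) (u v : α → ℝ),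
      (∀ y ∈ Ωh ∪ bΩh, y ≠ x → u y = v y) → Fh x z u = Fh x z v)
    (hpos : ∀ x ∈ Ωh, ∀ (z τ : ℝ) (u η : α → ℝ),
      (∀ y ∈ Ωh ∪ bΩh, 0 ≤ η y ∧ η y ≤ τ) →
      Fh x z (u + η) ≥ Fh x z u ∧ Fh x z u ≥ Fh x (z + τ) (u + η))
    (hhom : ∀ x ∈ Ωh, ∀ (t z : ℝ), 0 ≤ t → ∀ u : α → ℝ,
      Fh x (t * z) (t • u) = t * Fh x z u)
    (B : Finset α) (hB : B ⊆ Ωh)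
    (σ : α → ℝ) (x₀ : α) (hx₀ : x₀ ∈ B) (hσx₀ : 0 < σ x₀)
    (hσout : ∀ y ∈ Ωh ∪ bΩh, y ∉ B → σ y ≤ 0)
    (τ : ℝ) (hστ : ∀ x ∈ B, Fh x (σ x) σ + τ * σ x ≥ 0)
    (lam : ℝ) (φ : α → ℝ)
    (hφ0 : ∀ y ∈ Ωh ∪ bΩh, 0 ≤ φ y) (hφpos : ∀ x ∈ Ωh, 0 < φ x)
    (hφ : ∀ x ∈ Ωh, Fh x (φ x) φ + lam * φ x ≤ 0) :
    lam ≤ τ := by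
  obtain ⟨x₁, hx₁, hmax⟩ := B.exists_max_image (fun x => σ x / φ x) ⟨x₀, hx₀⟩
  have hφ₁ := hφpos x₁ (hB hx₁)
  obtain ⟨t, ht⟩ : ∃ t, t = σ x₁ / φ x₁ := ⟨_, rfl⟩
  simp only [← ht] at hmax
  have ht_pos : 0 < t := (div_pos hσx₀ (hφpos x₀ (hB hx₀))).trans_le (hmax x₀ hx₀)
  have htouch : t * φ x₁ = σ x₁ := by rw [ht, div_mul_cancel₀ _ hφ₁.ne']
  have hle : ∀ y ∈ Ωh ∪ bΩh, σ y ≤ t * φ y := fun y hy => by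
    by_cases hyB : y ∈ B
    · exact (div_le_iff₀ (hφpos y (hB hyB))).1 (hmax y hyB)
    · exact (hσout y hy hyB).trans (mul_nonneg ht_pos.le (hφ0 y hy))
  obtain ⟨M, hM⟩ := ((Ωh ∪ bΩh).image (t • φ - σ)).bddAbove
  have hcmp := (hpos x₁ (hB hx₁) (σ x₁) M σ (t • φ - σ) fun y hy =>
    ⟨sub_nonneg.2 (hle y hy), hM (Finset.mem_coe.2 (Finset.mem_image_of_mem _ hy))⟩).1
  rw [add_sub_cancel, ← htouch, hhom x₁ (hB hx₁) t (φ x₁) ht_pos.le φ, htouch] at hcmp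
  have hsub := hστ x₁ hx₁
  have hsuper := mul_le_mul_of_nonneg_left (hφ x₁ (hB hx₁)) ht_pos.le
  have hσ₁ : 0 < σ x₁ := htouch ▸ mul_pos ht_pos hφ₁
  refine le_of_mul_le_mul_right ?_ hσ₁
  have hlam : lam * σ x₁ = t * (lam * φ x₁) := by rw [← htouch]; ring
  linarith
end

section
/- Assume additionally that F_h is positively homogeneous: F_h(x,tz,tu) = t·F_h(x,z,u) for all t ≥ 0. Let λ ∈ ℝ and let f : Ω_h → ℝ satisfy f(x) ≤ 0 for all x ∈ Ω_h. Assume there exist μ > λ and a mesh function φ with φ ≥ 0 on hℤⁿ, φ(x) > 0 for all x ∈ Ω_h, and F_h[φ](x) + μφ(x) ≤ 0 for all x ∈ Ω_h. Then there exists a mesh function u with u ≥ 0 on hℤⁿ, u = 0 on hℤⁿ ∖ Ω_h, and F_h[u](x) + λu(x) = f(x) for all x ∈ Ω_h. -/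
/-- Perron's method on a finite set: an operator that is continuous and monotone in the off-centre
values, has `0` as a subsolution and `w ≥ 0` as a supersolution, has a nonnegative solution that
vanishes off the finite set. -/
theorem exists_nonneg_solution_of_supersolution {ι : Type*} (s : Finset ι)
    (G : ι → ℝ → (ι → ℝ) → ℝ)
    (hcont : ∀ x ∈ s, Continuous (fun p : ℝ × (ι → ℝ) => G x p.1 p.2))
    (hmono : ∀ x ∈ s, ∀ z, Monotone (G x z))
    (f w : ι → ℝ) (hsub : ∀ x ∈ s, f x ≤ G x 0 0) (hw : 0 ≤ w)
    (hsup : ∀ x ∈ s, G x (w x) w ≤ f x) :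
    ∃ u : ι → ℝ, (∀ ξ, 0 ≤ u ξ) ∧ (∀ ξ ∉ s, u ξ = 0) ∧ ∀ x ∈ s, G x (u x) u = f x := by
  classical
  let w₀ : ι → ℝ := fun ξ => if ξ ∈ s then w ξ else 0
  have hw₀ : 0 ≤ w₀ := fun ξ => by
    dsimp only [w₀]
    split_ifs
    exacts [hw ξ, le_rfl]
  have hw₀w : w₀ ≤ w := fun ξ => by
    dsimp only [w₀]
    split_ifs
    exacts [le_rfl, hw ξ]
  have hGcont : ∀ x ∈ s, Continuous (fun u : ι → ℝ => G x (u x) u) := fun x hx =>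
    (hcont x hx).comp (f := fun u : ι → ℝ => (u x, u)) (by fun_prop)
  let S : Set (ι → ℝ) := Set.Icc 0 w₀ ∩ ⋂ x ∈ s, {u | G x (u x) u ≤ f x}
  have hS : IsCompact S := by
    refine IsCompact.inter_right ?_ (isClosed_biInter fun x hx =>
      isClosed_le (hGcont x hx) continuous_const)
    rw [← Set.pi_univ_Icc]
    exact isCompact_univ_pi fun _ => isCompact_Icc
  have hw₀S : w₀ ∈ S := by
    refine ⟨⟨hw₀, le_rfl⟩, Set.mem_iInter₂.2 fun x hx => ?_⟩
    have hwx : w₀ x = w x := if_pos hx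
    simp only [Set.mem_ofPred_eq, hwx]
    exact (hmono x hx _ hw₀w).trans (hsup x hx)
  obtain ⟨u, ⟨⟨hu0, huw⟩, hu⟩, hmin⟩ := hS.exists_isMinOn ⟨w₀, hw₀S⟩
    (f := fun u => ∑ x ∈ s, u x) (by fun_prop)
  have hu : ∀ x ∈ s, G x (u x) u ≤ f x := fun x hx => Set.mem_iInter₂.1 hu x hx
  refine ⟨u, hu0, fun ξ hξ => le_antisymm ((huw ξ).trans_eq (if_neg hξ)) (hu0 ξ), fun a ha => ?_⟩
  by_contra hne
  have hlt : G a (u a) u < f a := lt_of_le_of_ne (hu a ha) hne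
  have hua : 0 < u a := by
    refine lt_of_le_of_ne (hu0 a) fun h0 => ?_
    have := hmono a ha 0 hu0
    have := hsub a ha
    rw [← h0] at hlt
    linarith
  have hlower : ∀ᶠ t in nhds (u a), G a t (Function.update u a t) < f a := by
    have hc : Continuous fun t => G a t (Function.update u a t) :=
      (hcont a ha).comp (f := fun t => (t, Function.update u a t))
        (continuous_id.prodMk (continuous_const.update a continuous_id))
    refine hc.continuousAt.eventually_lt continuousAt_const ?_
    simpa using hlt
  obtain ⟨t, ht, ht0, hta⟩ : ∃ t, G a t (Function.update u a t) < f a ∧ 0 < t ∧ t < u a :=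
    ((hlower.filter_mono nhdsWithin_le_nhds).and (Ioo_mem_nhdsLT hua)).exists
  have hvu : Function.update u a t ≤ u := update_le_self_iff.2 hta.le
  have hvS : Function.update u a t ∈ S := by
    refine ⟨⟨fun ξ => ?_, hvu.trans huw⟩, Set.mem_iInter₂.2 fun x hx => ?_⟩
    · rcases eq_or_ne ξ a with rfl | hξ
      · simpa using ht0.le
      · simpa [hξ] using hu0 ξ
    · rcases eq_or_ne x a with rfl | hxa
      · simpa using ht.le
      · simpa [hxa] using (hmono x hx _ hvu).trans (hu x hx)
  have hlt_sum : ∑ x ∈ s, Function.update u a t x < ∑ x ∈ s, u x :=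
    Finset.sum_lt_sum (fun x _ => hvu x) ⟨a, ha, by simpa using hta⟩
  exact absurd (isMinOn_iff.1 hmin _ hvS) (not_le.2 hlt_sum)

/-- existence of a nonnegative solution of the Dirichlet problem
F_h[u] + λu = f (f ≤ 0) for λ below the discrete principal eigenvalue. -/
theorem discrete_existence_below_eigenvalue
    (n : ℕ) (hn : 1 ≤ n) (h : ℝ) (hh : 0 < h)
    (Y : Finset (Fin n → ℤ)) (hY0 : (0 : Fin n → ℤ) ∉ Y)
    (hYbasis : ∀ i : Fin n, Pi.single i 1 ∈ Y)
    (Ωh : Finset (Fin n → ℤ)) (hΩne : Ωh.Nonempty)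
    (Fh : (Fin n → ℤ) → ℝ → ((Fin n → ℤ) → ℝ) → ℝ)
    (hloc : ∀ x ∈ Ωh, ∀ (z : ℝ) (u v : (Fin n → ℤ) → ℝ),
      (∀ y ∈ Y, u (x + y) = v (x + y) ∧ u (x - y) = v (x - y)) → Fh x z u = Fh x z v)
    (hcont : ∀ x ∈ Ωh, Continuous (fun p : ℝ × ((Fin n → ℤ) → ℝ) => Fh x p.1 p.2))
    (hpos : ∀ x ∈ Ωh, ∀ (z τ : ℝ) (u η : (Fin n → ℤ) → ℝ),
      (∀ ξ, 0 ≤ η ξ ∧ η ξ ≤ τ) →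
      Fh x z (u + η) ≥ Fh x z u ∧ Fh x z u ≥ Fh x (z + τ) (u + η))
    (α₀ : ℝ) (hα₀ : 0 < α₀)
    (hell : ∀ x ∈ Ωh, ∀ (z : ℝ) (u η : (Fin n → ℤ) → ℝ), (∀ ξ, 0 ≤ η ξ) →
      Fh x z (u + η) - Fh x z u ≥
        α₀ * ∑ y ∈ Y, (η (x + y) + η (x - y)) / (h ^ 2 * (ynorm y) ^ 2))
    (hhom : ∀ x ∈ Ωh, ∀ (t z : ℝ), 0 ≤ t → ∀ u : (Fin n → ℤ) → ℝ,
      Fh x (t * z) (t • u) = t * Fh x z u)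
    (lam : ℝ) (f : (Fin n → ℤ) → ℝ) (hf : ∀ x ∈ Ωh, f x ≤ 0)
    (μ : ℝ) (hμ : lam < μ)
    (φ : (Fin n → ℤ) → ℝ) (hφ0 : ∀ ξ, 0 ≤ φ ξ) (hφpos : ∀ x ∈ Ωh, 0 < φ x)
    (hφ : ∀ x ∈ Ωh, Fh x (φ x) φ + μ * φ x ≤ 0) :
    ∃ u : (Fin n → ℤ) → ℝ, (∀ ξ, 0 ≤ u ξ) ∧ (∀ ξ ∉ Ωh, u ξ = 0) ∧
      ∀ x ∈ Ωh, Fh x (u x) u + lam * u x = f x := by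
  have hmono : ∀ x ∈ Ωh, ∀ z, Monotone (Fh x z) := fun x hx z u v huv => by
    have hη : ∀ ξ, 0 ≤ (v - u) ξ := fun ξ => sub_nonneg.2 (huv ξ)
    have hF := hell x hx z u (v - u) hη
    rw [add_sub_cancel] at hF
    have hsum : 0 ≤ α₀ * ∑ y ∈ Y,
        ((v - u) (x + y) + (v - u) (x - y)) / (h ^ 2 * (ynorm y) ^ 2) :=
      mul_nonneg hα₀.le <| Finset.sum_nonneg fun y _ =>
        div_nonneg (add_nonneg (hη _) (hη _)) (by positivity)
    linarith
  have hμ' : 0 < μ - lam := sub_pos.2 hμ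
  let t : ℝ := ∑ x ∈ Ωh, -f x / ((μ - lam) * φ x)
  have hterm : ∀ x ∈ Ωh, 0 ≤ -f x / ((μ - lam) * φ x) := fun x hx =>
    div_nonneg (neg_nonneg.2 (hf x hx)) (mul_pos hμ' (hφpos x hx)).le
  have ht : 0 ≤ t := Finset.sum_nonneg hterm
  have htf : ∀ x ∈ Ωh, -f x ≤ t * ((μ - lam) * φ x) := fun x hx =>
    (div_le_iff₀ (mul_pos hμ' (hφpos x hx))).1 (Finset.single_le_sum hterm hx)
  refine exists_nonneg_solution_of_supersolution Ωh (fun x z u => Fh x z u + lam * z)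
    (fun x hx => (hcont x hx).add (continuous_const.mul continuous_fst))
    (fun x hx z u v huv => by simpa using hmono x hx z huv) f (t • φ) (fun x hx => ?_)
    (fun ξ => mul_nonneg ht (hφ0 ξ)) (fun x hx => ?_)
  · have h0 := hhom x hx 0 0 le_rfl 0
    simp only [zero_mul, zero_smul] at h0
    simpa [h0] using hf x hx
  · have hscale := hhom x hx t (φ x) ht φ
    have hsuper := mul_le_mul_of_nonneg_left (hφ x hx) ht
    have := htf x hx
    simp only [Pi.smul_apply, smul_eq_mul, hscale]
    linarith
end

section
/- Assume additionally that F_h is positively homogeneous: F_h(x,tz,tu) = t·F_h(x,z,u) for all t ≥ 0. Let Λ := { λ ∈ ℝ : there exists a mesh function φ with φ ≥ 0 on hℤⁿ, φ(x) > 0 for all x ∈ Ω_h, and F_h[φ](x) + λφ(x) ≤ 0 for all x ∈ Ω_h }, and suppose Λ is nonempty and bounded above, with λ_{1,h} := sup Λ. Then the inf-sup formula holds: λ_{1,h} = − inf { max_{x∈Ω_h} F_h[φ](x)/φ(x) : φ a mesh function with φ = 0 on hℤⁿ ∖ Ω_h and φ(x) > 0 for all x ∈ Ω_h }. -/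
/-- the inf-sup formula for the discrete principal eigenvalue
λ_{1,h} = sup Λ. -/
theorem discrete_principal_eigenvalue_infsup
    (n : ℕ) (hn : 1 ≤ n) (h : ℝ) (hh : 0 < h)
    (Y : Finset (Fin n → ℤ)) (hY0 : (0 : Fin n → ℤ) ∉ Y)
    (hYbasis : ∀ i : Fin n, Pi.single i 1 ∈ Y)
    (Ωh : Finset (Fin n → ℤ)) (hΩne : Ωh.Nonempty)
    (Fh : (Fin n → ℤ) → ℝ → ((Fin n → ℤ) → ℝ) → ℝ)
    (hloc : ∀ x ∈ Ωh, ∀ (z : ℝ) (u v : (Fin n → ℤ) → ℝ),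
      (∀ y ∈ Y, u (x + y) = v (x + y) ∧ u (x - y) = v (x - y)) → Fh x z u = Fh x z v)
    (hcont : ∀ x ∈ Ωh, Continuous (fun p : ℝ × ((Fin n → ℤ) → ℝ) => Fh x p.1 p.2))
    (hpos : ∀ x ∈ Ωh, ∀ (z τ : ℝ) (u η : (Fin n → ℤ) → ℝ),
      (∀ ξ, 0 ≤ η ξ ∧ η ξ ≤ τ) →
      Fh x z (u + η) ≥ Fh x z u ∧ Fh x z u ≥ Fh x (z + τ) (u + η))
    (α₀ : ℝ) (hα₀ : 0 < α₀)
    (hell : ∀ x ∈ Ωh, ∀ (z : ℝ) (u η : (Fin n → ℤ) → ℝ), (∀ ξ, 0 ≤ η ξ) →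
      Fh x z (u + η) - Fh x z u ≥
        α₀ * ∑ y ∈ Y, (η (x + y) + η (x - y)) / (h ^ 2 * (ynorm y) ^ 2))
    (hhom : ∀ x ∈ Ωh, ∀ (t z : ℝ), 0 ≤ t → ∀ u : (Fin n → ℤ) → ℝ,
      Fh x (t * z) (t • u) = t * Fh x z u)
    (hne : {lam : ℝ | ∃ φ : (Fin n → ℤ) → ℝ,
        (∀ ξ, 0 ≤ φ ξ) ∧ (∀ x ∈ Ωh, 0 < φ x) ∧
        ∀ x ∈ Ωh, Fh x (φ x) φ + lam * φ x ≤ 0}.Nonempty)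
    (hbdd : BddAbove {lam : ℝ | ∃ φ : (Fin n → ℤ) → ℝ,
        (∀ ξ, 0 ≤ φ ξ) ∧ (∀ x ∈ Ωh, 0 < φ x) ∧
        ∀ x ∈ Ωh, Fh x (φ x) φ + lam * φ x ≤ 0}) :
    sSup {lam : ℝ | ∃ φ : (Fin n → ℤ) → ℝ,
        (∀ ξ, 0 ≤ φ ξ) ∧ (∀ x ∈ Ωh, 0 < φ x) ∧
        ∀ x ∈ Ωh, Fh x (φ x) φ + lam * φ x ≤ 0}
      = - sInf {m : ℝ | ∃ φ : (Fin n → ℤ) → ℝ,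
          (∀ ξ ∉ Ωh, φ ξ = 0) ∧ (∀ x ∈ Ωh, 0 < φ x) ∧
          m = Ωh.sup' hΩne (fun x => Fh x (φ x) φ / φ x)} := by
  set L := {lam : ℝ | ∃ φ : (Fin n → ℤ) → ℝ,
        (∀ ξ, 0 ≤ φ ξ) ∧ (∀ x ∈ Ωh, 0 < φ x) ∧
        ∀ x ∈ Ωh, Fh x (φ x) φ + lam * φ x ≤ 0}
  set M := {m : ℝ | ∃ φ : (Fin n → ℤ) → ℝ,
          (∀ ξ ∉ Ωh, φ ξ = 0) ∧ (∀ x ∈ Ωh, 0 < φ x) ∧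
          m = Ωh.sup' hΩne (fun x => Fh x (φ x) φ / φ x)}
  have neg_mem : ∀ m ∈ M, -m ∈ L := by
    rintro m ⟨φ, hφ0, hφpos, rfl⟩
    refine ⟨φ, fun ξ => ?_, hφpos, fun x hx => ?_⟩
    · by_cases hξ : ξ ∈ Ωh
      · exact (hφpos ξ hξ).le
      · exact (hφ0 ξ hξ).ge
    · have hle := Finset.le_sup' (fun x => Fh x (φ x) φ / φ x) hx
      rw [div_le_iff₀ (hφpos x hx)] at hle
      linarith
  have exists_le_neg : ∀ lam ∈ L, ∃ m ∈ M, m ≤ -lam := by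
    rintro lam ⟨φ, hφ0, hφpos, hφ⟩
    let ψ : (Fin n → ℤ) → ℝ := fun ξ => if ξ ∈ Ωh then φ ξ else 0
    have hψ : ∀ x ∈ Ωh, ψ x = φ x := fun x hx => if_pos hx
    have hη : ∀ ξ, 0 ≤ (φ - ψ) ξ := fun ξ => by
      by_cases hξ : ξ ∈ Ωh
      · simp [hψ ξ hξ]
      · simpa [ψ, hξ] using hφ0 ξ
    refine ⟨_, ⟨ψ, fun ξ hξ => if_neg hξ, fun x hx => (hψ x hx).symm ▸ hφpos x hx, rfl⟩, ?_⟩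
    refine Finset.sup'_le _ _ fun x hx => ?_
    rw [hψ x hx, div_le_iff₀ (hφpos x hx)]
    have hsum : 0 ≤ α₀ * ∑ y ∈ Y,
        ((φ - ψ) (x + y) + (φ - ψ) (x - y)) / (h ^ 2 * (ynorm y) ^ 2) :=
      mul_nonneg hα₀.le <| Finset.sum_nonneg fun y _ =>
        div_nonneg (add_nonneg (hη _) (hη _)) (by positivity)
    have hmono := hell x hx (φ x) ψ (φ - ψ) hη
    rw [add_sub_cancel] at hmono
    linarith [hφ x hx]
  have hMne : M.Nonempty := by
    obtain ⟨lam, hlam⟩ := hne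
    obtain ⟨m, hm, -⟩ := exists_le_neg lam hlam
    exact ⟨m, hm⟩
  have hMbdd : BddBelow M := ⟨-sSup L, fun m hm => by
    linarith [le_csSup hbdd (neg_mem m hm)]⟩
  apply le_antisymm
  · refine csSup_le hne fun lam hlam => ?_
    obtain ⟨m, hm, hle⟩ := exists_le_neg lam hlam
    linarith [csInf_le hMbdd hm]
  · rw [neg_le]
    exact le_csInf hMne fun m hm => by linarith [le_csSup hbdd (neg_mem m hm)]
end

section
/- For every f : Ω_h → ℝ and every g : hℤⁿ → ℝ there exists a unique mesh function u such that u(x) = g(x) for all x ∈ hℤⁿ ∖ Ω_h and F_h[u](x) = f(x) for all x ∈ Ω_h (well-posedness of the discrete Dirichlet problem). -/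
/-- An operator `K`, mapping a point, a value at that point and a function to a real number, is
elliptic along `σ` on `Ω` when it is monotone in the function, with rate at least `c > 0` in the
value at `σ x`, and does not increase when a nonnegative constant is added to both arguments. -/
structure IsEllipticAlong {ι : Type*} (σ : ι → ι) (Ω : Finset ι) (c : ℝ)
    (K : ι → ℝ → (ι → ℝ) → ℝ) : Prop where
  pos : 0 < c
  mono : ∀ x ∈ Ω, ∀ z u v, u ≤ v → K x z u + c * (v (σ x) - u (σ x)) ≤ K x z v
  shift : ∀ x ∈ Ω, ∀ z τ u, 0 ≤ τ → K x (z + τ) (fun ξ => u ξ + τ) ≤ K x z u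

namespace IsEllipticAlong

variable {ι : Type*} {σ : ι → ι} {Ω : Finset ι} {c : ℝ} {K : ι → ℝ → (ι → ℝ) → ℝ}

lemma monotone (hK : IsEllipticAlong σ Ω c K) {x : ι} (hx : x ∈ Ω) (z : ℝ) :
    Monotone (K x z) := fun u v huv => by
  have h1 := hK.mono x hx z u v huv
  have h2 := mul_nonneg hK.pos.le (sub_nonneg.2 (huv (σ x)))
  linarith

lemma antitone (hK : IsEllipticAlong σ Ω c K) {x : ι} (hx : x ∈ Ω) (u : ι → ℝ) :
    Antitone (fun z => K x z u) := fun z w hzw => by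
  have h1 := hK.shift x hx z (w - z) u (sub_nonneg.2 hzw)
  rw [add_sub_cancel] at h1
  exact (hK.monotone hx w fun ξ => by linarith).trans h1

/-- Reflecting both arguments and the value preserves ellipticity. -/
lemma reflect (hK : IsEllipticAlong σ Ω c K) :
    IsEllipticAlong σ Ω c (fun x z u => -K x (-z) (-u)) where
  pos := hK.pos
  mono x hx z u v huv := by
    have h1 := hK.mono x hx (-z) (-v) (-u) (neg_le_neg huv)
    simp only [Pi.neg_apply] at h1
    linarith
  shift x hx z τ u hτ := by
    have h1 := hK.shift x hx (-(z + τ)) τ (-fun ξ => u ξ + τ) hτ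
    have h2 : (fun ξ => (-fun ξ => u ξ + τ) ξ + τ) = -u := by
      ext ξ; simp
    rw [h2, show -(z + τ) + τ = -z by ring] at h1
    linarith

/-- Adding a nonincreasing zero-order term preserves ellipticity. -/
lemma add_antitone (hK : IsEllipticAlong σ Ω c K) {θ : ℝ → ℝ} (hθ : Antitone θ) :
    IsEllipticAlong σ Ω c (fun x z u => K x z u + θ z) where
  pos := hK.pos
  mono x hx z u v huv := by
    have h1 := hK.mono x hx z u v huv
    linarith
  shift x hx z τ u hτ := by
    have h1 := hK.shift x hx z τ u hτ
    have h2 : θ (z + τ) ≤ θ z := hθ (by linarith)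
    linarith

/-- Comparison principle. -/
lemma comparison (hK : IsEllipticAlong σ Ω c K) (hσ : ∀ x, ∃ k, σ^[k] x ∉ Ω) {u v : ι → ℝ}
    (hout : ∀ ξ ∉ Ω, u ξ ≤ v ξ) (hin : ∀ x ∈ Ω, K x (v x) v ≤ K x (u x) u) : u ≤ v := by
  intro ξ
  by_contra! hξ
  have hξΩ : ξ ∈ Ω := by
    by_contra hc
    exact absurd (hout ξ hc) hξ.not_ge
  obtain ⟨x, hx, hmax⟩ := Ω.exists_max_image (fun ξ => u ξ - v ξ) ⟨ξ, hξΩ⟩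
  obtain ⟨M, hM⟩ : ∃ M, M = u x - v x := ⟨_, rfl⟩
  have hM0 : 0 < M := by
    have := hmax ξ hξΩ
    linarith
  have hle : ∀ ζ, u ζ ≤ v ζ + M := fun ζ => by
    by_cases hζ : ζ ∈ Ω
    · have := hmax ζ hζ
      linarith
    · have := hout ζ hζ
      linarith
  have hiter : ∀ k, u (σ^[k] x) = v (σ^[k] x) + M ∧ σ^[k] x ∈ Ω := by
    intro k
    have hmem : ∀ ζ, u ζ = v ζ + M → ζ ∈ Ω := fun ζ h1 => by
      by_contra hζ
      have := hout ζ hζ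
      linarith
    suffices h : u (σ^[k] x) = v (σ^[k] x) + M from ⟨h, hmem _ h⟩
    induction k with
    | zero => simp [hM]
    | succ k ih =>
      have hy := hmem _ ih
      rw [Function.iterate_succ_apply']
      generalize σ^[k] x = y at ih hy
      have h1 := hK.mono y hy (u y) u (fun ζ => v ζ + M) hle
      have h2 := hK.shift y hy (v y) M v hM0.le
      rw [← ih] at h2
      have h3 := hin y hy
      have h4 : c * (v (σ y) + M - u (σ y)) ≤ 0 := by linarith
      have h5 := nonpos_of_mul_nonpos_right h4 hK.pos
      have h6 := hle (σ y)
      linarith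
  obtain ⟨k, hk⟩ := hσ x
  exact hk (hiter k).2

/-- If a subsolution is within a fixed distance of its upper bound `M` at a given point, then `M`
is bounded independently of the subsolution. -/
lemma exists_bound_of_near_max (hK : IsEllipticAlong σ Ω c K) (hσ : ∀ x, ∃ k, σ^[k] x ∉ Ω)
    (f : ι → ℝ) (b : ℝ) (x : ι) (C : ℝ) :
    ∃ B, ∀ u : ι → ℝ, (∀ ξ ∉ Ω, u ξ ≤ b) → (∀ y ∈ Ω, f y ≤ K y (u y) u) →
      ∀ M, 0 ≤ M → (∀ ξ, u ξ ≤ M) → M - C ≤ u x → M ≤ B := by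
  obtain ⟨k, hk⟩ := hσ x
  induction k generalizing x C with
  | zero =>
    refine ⟨b + C, fun u hout _ M _ _ hC => ?_⟩
    have := hout x hk
    linarith
  | succ k ih =>
    by_cases hx : x ∈ Ω
    · obtain ⟨B, hB⟩ := ih (σ x) ((K x (-C) (fun _ => 0) - f x) / c) hk
      refine ⟨B, fun u hout hin M hM hle hC => hB u hout hin M hM hle ?_⟩
      have h1 := hK.mono x hx (u x) u (fun _ => M) hle
      have h2 : K x (u x) (fun _ => M) ≤ K x (M - C) (fun _ => M) := hK.antitone hx _ hC
      have h3 := hK.shift x hx (-C) M (fun _ => 0) hM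
      simp only [zero_add] at h3
      rw [neg_add_eq_sub] at h3
      have h4 := hin x hx
      have h5 : M - u (σ x) ≤ (K x (-C) (fun _ => 0) - f x) / c := by
        rw [le_div_iff₀ hK.pos]
        linarith
      linarith
    · refine ⟨b + C, fun u hout _ M _ _ hC => ?_⟩
      have := hout x hx
      linarith

/-- A priori upper bound for subsolutions. -/
lemma exists_upper_bound (hK : IsEllipticAlong σ Ω c K) (hσ : ∀ x, ∃ k, σ^[k] x ∉ Ω)
    (f : ι → ℝ) (b : ℝ) :
    ∃ B, ∀ u : ι → ℝ, (∀ ξ ∉ Ω, u ξ ≤ b) → (∀ y ∈ Ω, f y ≤ K y (u y) u) →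
      ∀ ξ, u ξ ≤ B := by
  choose B hB using fun x => hK.exists_bound_of_near_max hσ f b x 0
  refine ⟨|b| + ∑ x ∈ Ω, |B x|, fun u hout hin ξ => ?_⟩
  have hS : 0 ≤ ∑ x ∈ Ω, |B x| := Finset.sum_nonneg fun _ _ => abs_nonneg _
  by_cases hξ : ξ ∈ Ω
  · obtain ⟨x, hx, hmax⟩ := Ω.exists_max_image u ⟨ξ, hξ⟩
    have h1 := hmax ξ hξ
    rcases le_total (u x) |b| with h2 | h2
    · linarith
    · have h3 := hB x u hout hin (u x) ((abs_nonneg b).trans h2) (fun ζ => by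
        by_cases hζ : ζ ∈ Ω
        · exact hmax ζ hζ
        · exact (hout ζ hζ).trans ((le_abs_self b).trans h2)) (by simp)
      have h4 := Finset.single_le_sum (f := fun x => |B x|) (fun _ _ => abs_nonneg _) hx
      have h5 := le_abs_self (B x)
      have h6 := abs_nonneg b
      linarith
  · have := hout ξ hξ
    have := le_abs_self b
    linarith

end IsEllipticAlong

/-- Perron's method: if subsolutions exist and are bounded above, then a solution exists. -/
lemma exists_solution_of_subsolution {ι : Type*} [DecidableEq ι] {Ω : Finset ι}
    {K : ι → ℝ → (ι → ℝ) → ℝ} (hmono : ∀ x ∈ Ω, ∀ z, Monotone (K x z))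
    (hcont : ∀ x ∈ Ω, ∀ u, Continuous fun z => K x z u)
    (hloc : ∀ x ∈ Ω, ∀ z u t, K x z (Function.update u x t) = K x z u) {f g u₀ : ι → ℝ} {B : ℝ}
    (hu₀ : (∀ ξ ∉ Ω, u₀ ξ = g ξ) ∧ ∀ x ∈ Ω, f x ≤ K x (u₀ x) u₀)
    (hB : ∀ u : ι → ℝ, (∀ ξ ∉ Ω, u ξ = g ξ) → (∀ x ∈ Ω, f x ≤ K x (u x) u) → ∀ ξ, u ξ ≤ B) :
    ∃ u : ι → ℝ, (∀ ξ ∉ Ω, u ξ = g ξ) ∧ ∀ x ∈ Ω, K x (u x) u = f x := by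
  obtain ⟨S, hS⟩ : ∃ S : Set (ι → ℝ),
    S = {u | (∀ ξ ∉ Ω, u ξ = g ξ) ∧ ∀ x ∈ Ω, f x ≤ K x (u x) u} := ⟨_, rfl⟩
  have hmemS : ∀ u, u ∈ S ↔ (∀ ξ ∉ Ω, u ξ = g ξ) ∧ ∀ x ∈ Ω, f x ≤ K x (u x) u := fun u => by
    rw [hS]; rfl
  have hu₀S : u₀ ∈ S := (hmemS _).2 hu₀
  have hne : S.Nonempty := ⟨u₀, hu₀S⟩
  have hbdd : BddAbove S := ⟨fun _ => B, fun u hu ξ =>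
    hB u ((hmemS u).1 hu).1 ((hmemS u).1 hu).2 ξ⟩
  obtain ⟨U, hU⟩ : ∃ U, IsLUB S U := ⟨_, isLUB_csSup hne hbdd⟩
  have hUpt : ∀ ξ, IsLUB (Function.eval ξ '' S) (U ξ) := isLUB_pi.1 hU
  have hUout : ∀ ξ ∉ Ω, U ξ = g ξ := fun ξ hξ => by
    apply le_antisymm
    · refine (hUpt ξ).2 ?_
      rintro _ ⟨u, hu, rfl⟩
      exact (((hmemS u).1 hu).1 ξ hξ).le
    · rw [← hu₀.1 ξ hξ]
      exact hU.1 hu₀S ξ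
  have hUin : ∀ x ∈ Ω, f x ≤ K x (U x) U := fun x hx => by
    have hclosed : IsClosed {z | f x ≤ K x z U} := isClosed_le continuous_const (hcont x hx U)
    refine hclosed.closure_subset_iff.2 ?_ ((hUpt x).mem_closure (hne.image _))
    rintro _ ⟨u, hu, rfl⟩
    exact (((hmemS u).1 hu).2 x hx).trans (hmono x hx _ (hU.1 hu))
  refine ⟨U, hUout, fun x hx => le_antisymm ?_ (hUin x hx)⟩
  by_contra! hlt
  obtain ⟨z, hz, hzU⟩ : ∃ z, f x < K x z U ∧ U x < z := by
    have h1 : ∀ᶠ z in nhdsWithin (U x) (Set.Ioi (U x)), f x < K x z U :=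
      ((hcont x hx U).continuousAt.eventually_const_lt hlt).filter_mono nhdsWithin_le_nhds
    exact (h1.and self_mem_nhdsWithin).exists
  have hle : U ≤ Function.update U x z := by
    rw [le_update_iff]
    exact ⟨hzU.le, fun _ _ => le_rfl⟩
  have hmem : Function.update U x z ∈ S := by
    refine (hmemS _).2 ⟨fun ξ hξ => ?_, fun y hy => ?_⟩
    · rw [Function.update_of_ne (ne_of_mem_of_not_mem hx hξ).symm, hUout ξ hξ]
    · by_cases hyx : y = x
      · subst hyx
        rw [Function.update_self, hloc y hy]
        exact hz.le
      · rw [Function.update_of_ne hyx]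
        exact (hUin y hy).trans (hmono y hy _ hle)
  have h1 := hU.1 hmem x
  rw [Function.update_self] at h1
  exact absurd h1 hzU.not_ge

/-- Existence for the Dirichlet problem of an elliptic operator with bounded exterior data. -/
lemma IsEllipticAlong.exists_solution {ι : Type*} [DecidableEq ι] {σ : ι → ι} {Ω : Finset ι}
    {c : ℝ} {K : ι → ℝ → (ι → ℝ) → ℝ} (hK : IsEllipticAlong σ Ω c K)
    (hσ : ∀ x, ∃ k, σ^[k] x ∉ Ω) (hcont : ∀ x ∈ Ω, ∀ u, Continuous fun z => K x z u)
    (hloc : ∀ x ∈ Ω, ∀ z u t, K x z (Function.update u x t) = K x z u) (f g : ι → ℝ) {b : ℝ}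
    (hb : ∀ ξ, |g ξ| ≤ b) :
    ∃ u : ι → ℝ, (∀ ξ ∉ Ω, u ξ = g ξ) ∧ ∀ x ∈ Ω, K x (u x) u = f x := by
  obtain ⟨A, hA⟩ := hK.reflect.exists_upper_bound hσ (-f) b
  -- The penalty enforces a subsolution and vanishes above the a priori lower bound `-A`.
  obtain ⟨θ, hθ⟩ : ∃ θ : ℝ → ℝ, θ = fun z => max (-z - A) 0 := ⟨_, rfl⟩
  have hθanti : Antitone θ := fun z w hzw => by
    rw [hθ]
    exact max_le_max_right _ (by linarith)
  have hθcont : Continuous θ := by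
    rw [hθ]
    fun_prop
  have hKθ := hK.add_antitone hθanti
  obtain ⟨B, hB⟩ := hKθ.exists_upper_bound hσ f b
  obtain ⟨T, hT⟩ : ∃ T, T = |b| + |A| + ∑ x ∈ Ω, |f x - K x 0 (fun _ => 0)| := ⟨_, rfl⟩
  have hsum : 0 ≤ ∑ x ∈ Ω, |f x - K x 0 (fun _ => 0)| := Finset.sum_nonneg fun _ _ => abs_nonneg _
  have hT0 : 0 ≤ T := by
    rw [hT]
    positivity
  obtain ⟨u, hout, hin⟩ := exists_solution_of_subsolution (f := f) (g := g) (B := B)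
    (u₀ := fun ξ => if ξ ∈ Ω then -T else g ξ) (fun x hx z => hKθ.monotone hx z)
    (fun x hx u => (hcont x hx u).add hθcont)
    (fun x hx z u t => by rw [hloc x hx])
    ⟨fun ξ hξ => if_neg hξ, fun x hx => by
      rw [if_pos hx]
      have h1 : K x (-T) (fun _ => -T) ≤ K x (-T) (fun ξ => if ξ ∈ Ω then -T else g ξ) :=
        hK.monotone hx _ fun ξ => by
          dsimp only
          split_ifs
          · exact le_rfl
          · have := (abs_le.1 (hb ξ)).1
            have := le_abs_self b
            have := abs_nonneg A
            linarith
      have h2 := hK.shift x hx (-T) T (fun _ => -T) hT0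
      simp only [neg_add_cancel] at h2
      have h3 : -(-T) - A ≤ θ (-T) := by
        rw [hθ]
        exact le_max_left _ _
      have h4 := Finset.single_le_sum (f := fun x => |f x - K x 0 (fun _ => 0)|)
        (fun _ _ => abs_nonneg _) hx
      have h5 := le_abs_self (f x - K x 0 (fun _ => 0))
      have := le_abs_self A
      have := abs_nonneg b
      linarith⟩
    (fun u hu => hB u fun ξ hξ => (hu ξ hξ).trans_le ((le_abs_self _).trans (hb ξ)))
  have hlow := hA (-u)
    (fun ξ hξ => by
      rw [Pi.neg_apply, hout ξ hξ]
      exact (neg_le_abs _).trans (hb ξ))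
    (fun x hx => by
      have h1 : 0 ≤ θ (u x) := by
        rw [hθ]
        exact le_max_right _ _
      have h2 := hin x hx
      simp only [Pi.neg_apply, neg_neg]
      linarith)
  refine ⟨u, hout, fun x hx => ?_⟩
  have h1 : θ (u x) = 0 := by
    have := hlow x
    rw [Pi.neg_apply] at this
    rw [hθ]
    exact max_eq_right (by linarith)
  have h2 := hin x hx
  rwa [h1, add_zero] at h2

lemma ynorm_single {n : ℕ} (i : Fin n) : ynorm (Pi.single i 1 : Fin n → ℤ) = 1 := by
  rw [ynorm, Finset.sum_eq_single i] <;> simp +contextual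

/-- Translation by a coordinate vector leaves every finite set after finitely many steps. -/
lemma exists_iterate_add_single_notMem {n : ℕ} (i : Fin n) (Ω : Finset (Fin n → ℤ))
    (x : Fin n → ℤ) : ∃ k : ℕ, (fun ξ : Fin n → ℤ => ξ + Pi.single i 1)^[k] x ∉ Ω := by
  by_contra! hmem
  refine Set.infinite_of_injective_forall_mem (fun k l hkl => ?_) hmem Ω.finite_toSet
  simpa using congrFun hkl i

/-- well-posedness of the discrete Dirichlet problem. -/
theorem discrete_dirichlet_wellposed
    (n : ℕ) (hn : 1 ≤ n) (h : ℝ) (hh : 0 < h)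
    (Y : Finset (Fin n → ℤ)) (hY0 : (0 : Fin n → ℤ) ∉ Y)
    (hYbasis : ∀ i : Fin n, Pi.single i 1 ∈ Y)
    (Ωh : Finset (Fin n → ℤ)) (hΩne : Ωh.Nonempty)
    (Fh : (Fin n → ℤ) → ℝ → ((Fin n → ℤ) → ℝ) → ℝ)
    (hloc : ∀ x ∈ Ωh, ∀ (z : ℝ) (u v : (Fin n → ℤ) → ℝ),
      (∀ y ∈ Y, u (x + y) = v (x + y) ∧ u (x - y) = v (x - y)) → Fh x z u = Fh x z v)
    (hcont : ∀ x ∈ Ωh, Continuous (fun p : ℝ × ((Fin n → ℤ) → ℝ) => Fh x p.1 p.2))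
    (hpos : ∀ x ∈ Ωh, ∀ (z τ : ℝ) (u η : (Fin n → ℤ) → ℝ),
      (∀ ξ, 0 ≤ η ξ ∧ η ξ ≤ τ) →
      Fh x z (u + η) ≥ Fh x z u ∧ Fh x z u ≥ Fh x (z + τ) (u + η))
    (α₀ : ℝ) (hα₀ : 0 < α₀)
    (hell : ∀ x ∈ Ωh, ∀ (z : ℝ) (u η : (Fin n → ℤ) → ℝ), (∀ ξ, 0 ≤ η ξ) →
      Fh x z (u + η) - Fh x z u ≥
        α₀ * ∑ y ∈ Y, (η (x + y) + η (x - y)) / (h ^ 2 * (ynorm y) ^ 2)) :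
    ∀ (f : (Fin n → ℤ) → ℝ) (g : (Fin n → ℤ) → ℝ),
      ∃! u : (Fin n → ℤ) → ℝ,
        (∀ ξ ∉ Ωh, u ξ = g ξ) ∧ ∀ x ∈ Ωh, Fh x (u x) u = f x := by
  classical
  intro f g
  let i : Fin n := ⟨0, hn⟩
  have hellip : IsEllipticAlong (fun ξ : Fin n → ℤ => ξ + Pi.single i 1) Ωh (α₀ / h ^ 2) Fh :=
    { pos := by positivity
      mono := fun x hx z u v huv => by
        have hη : ∀ ξ, 0 ≤ (v - u) ξ := fun ξ => sub_nonneg.2 (huv ξ)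
        have h1 := hell x hx z u (v - u) hη
        rw [add_sub_cancel] at h1
        have h2 := Finset.single_le_sum
          (f := fun y => ((v - u) (x + y) + (v - u) (x - y)) / (h ^ 2 * (ynorm y) ^ 2))
          (fun y _ => div_nonneg (add_nonneg (hη _) (hη _)) (by positivity)) (hYbasis i)
        rw [ynorm_single, one_pow, mul_one] at h2
        have h3 : (v - u) (x + Pi.single i 1) / h ^ 2 ≤
            ((v - u) (x + Pi.single i 1) + (v - u) (x - Pi.single i 1)) / h ^ 2 := by
          gcongr
          exact le_add_of_nonneg_right (hη _)
        have h4 := mul_le_mul_of_nonneg_left (h3.trans h2) hα₀.le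
        rw [Pi.sub_apply, ← mul_div_assoc, mul_div_right_comm] at h4
        linarith
      shift := fun x hx z τ u hτ => (hpos x hx z τ u (fun _ => τ) fun _ => ⟨hτ, le_rfl⟩).2 }
  have hσ := exists_iterate_add_single_notMem i Ωh
  have hlocal : ∀ x ∈ Ωh, ∀ z u t, Fh x z (Function.update u x t) = Fh x z u :=
    fun x hx z u t => hloc x hx z _ _ fun y hy => by
      have hy0 : y ≠ 0 := fun h0 => hY0 (h0 ▸ hy)
      constructor <;> exact Function.update_of_ne (by simpa using hy0) _ _
  -- Only finitely many exterior values matter, so the exterior data may be truncated.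
  let N : Finset (Fin n → ℤ) := (Ωh ×ˢ Y).image (fun p => p.1 + p.2) ∪
    (Ωh ×ˢ Y).image (fun p => p.1 - p.2)
  have hb : ∀ ξ, |if ξ ∈ N then g ξ else 0| ≤ ∑ ζ ∈ N, |g ζ| := fun ξ => by
    split_ifs with hξ
    · exact Finset.single_le_sum (f := fun ζ => |g ζ|) (fun _ _ => abs_nonneg _) hξ
    · rw [abs_zero]
      exact Finset.sum_nonneg fun _ _ => abs_nonneg _
  obtain ⟨w, hwout, hwin⟩ := hellip.exists_solution hσ
    (fun x hx u => (hcont x hx).comp (by fun_prop : Continuous fun z : ℝ => (z, u)))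
    hlocal f (fun ξ => if ξ ∈ N then g ξ else 0) hb
  have huniq : ∀ u v : (Fin n → ℤ) → ℝ, ((∀ ξ ∉ Ωh, u ξ = g ξ) ∧ ∀ x ∈ Ωh, Fh x (u x) u = f x) →
      ((∀ ξ ∉ Ωh, v ξ = g ξ) ∧ ∀ x ∈ Ωh, Fh x (v x) v = f x) → u ≤ v := fun u v hu hv =>
    hellip.comparison hσ (fun ξ hξ => ((hu.1 ξ hξ).trans (hv.1 ξ hξ).symm).le)
      fun x hx => ((hv.2 x hx).trans (hu.2 x hx).symm).le
  refine existsUnique_of_exists_of_unique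
    ⟨fun ξ => if ξ ∈ Ωh then w ξ else g ξ, fun ξ hξ => if_neg hξ, fun x hx => ?_⟩
    fun u v hu hv => le_antisymm (huniq u v hu hv) (huniq v u hv hu)
  have hN : ∀ ξ ∈ N, (if ξ ∈ Ωh then w ξ else g ξ) = w ξ := fun ξ hξ => by
    split_ifs with h1
    · rfl
    · rw [hwout ξ h1, if_pos hξ]
  dsimp only
  rw [if_pos hx, ← hwin x hx]
  exact hloc x hx _ _ _ fun y hy =>
    ⟨hN _ (Finset.mem_union_left _ (Finset.mem_image.2
        ⟨(x, y), Finset.mem_product.2 ⟨hx, hy⟩, rfl⟩)),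
      hN _ (Finset.mem_union_right _ (Finset.mem_image.2
        ⟨(x, y), Finset.mem_product.2 ⟨hx, hy⟩, rfl⟩))⟩
end

section
/- The function w satisfies: w(0) = w(π) = 0; w(x) > 0 for every x ∈ (0,π); w is continuously differentiable on [0,π] (one-sided derivatives at the endpoints) with w′(x₀) = 0; and w″(x) + k²·w(x) = 0 for all x ∈ (0,x₀), while 2·w″(x) + k²·w(x) = 0 for all x ∈ (x₀,π). In particular, setting a(x) = 1 for x ∈ [0,x₀) and a(x) = 2 for x ∈ [x₀,π], w is a positive C¹ function vanishing at 0 and π which satisfies a(x)·w″(x) + k²·w(x) = 0 classically on (0,π) ∖ {x₀}. -/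
open Real

/-- The constant k = (2+√2)/(2√2). -/
noncomputable def kconst : ℝ := (2 + Real.sqrt 2) / (2 * Real.sqrt 2)

/-- The junction point x₀ = π/(2k). -/
noncomputable def xjunc : ℝ := Real.pi / (2 * kconst)

/-- The piecewise eigenfunction w. -/
noncomputable def wfun : ℝ → ℝ := fun x =>
  if x ≤ xjunc then Real.sin (kconst * x)
  else Real.sin (kconst * x / Real.sqrt 2 + Real.pi * (2 - Real.sqrt 2) / 4)

theorem kconst_eq : kconst = (1 + √2) / 2 := by
  have hs : √2 * √2 = 2 := mul_self_sqrt (by norm_num)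
  have h0 : 0 < √2 := by positivity
  rw [kconst]
  field_simp
  linarith

theorem kconst_pos : 0 < kconst := by
  rw [kconst]
  positivity

theorem xjunc_pos : 0 < xjunc :=
  div_pos pi_pos (by linarith [kconst_pos])

theorem kconst_mul_xjunc : kconst * xjunc = π / 2 := by
  have h := kconst_pos.ne'
  rw [xjunc]
  field_simp

theorem xjunc_lt_pi : xjunc < π := by
  have h1 : 1 < √2 := by
    rw [lt_sqrt] <;> norm_num
  refine div_lt_self pi_pos ?_
  rw [kconst_eq]
  linarith

theorem right_phase_xjunc : kconst * xjunc / √2 + π * (2 - √2) / 4 = π / 2 := by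
  have hs : √2 * √2 = 2 := mul_self_sqrt (by norm_num)
  have h0 : √2 ≠ 0 := by positivity
  rw [kconst_mul_xjunc]
  field_simp
  linear_combination (-2 : ℝ) * hs

theorem right_phase_pi : kconst * π / √2 + π * (2 - √2) / 4 = π := by
  have hs : √2 * √2 = 2 := mul_self_sqrt (by norm_num)
  have h0 : √2 ≠ 0 := by positivity
  rw [kconst_eq]
  field_simp
  linear_combination (-2 : ℝ) * hs

/-- The derivative of `wfun`. -/
noncomputable def wfunDeriv : ℝ → ℝ := fun x =>
  if x ≤ xjunc then kconst * cos (kconst * x)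
  else kconst / √2 * cos (kconst * x / √2 + π * (2 - √2) / 4)

theorem wfunDeriv_xjunc : wfunDeriv xjunc = 0 := by
  simp [wfunDeriv, kconst_mul_xjunc]

theorem continuous_wfunDeriv : Continuous wfunDeriv := by
  refine Continuous.if_le (by fun_prop) (by fun_prop) continuous_id continuous_const ?_
  rintro x rfl
  rw [right_phase_xjunc, kconst_mul_xjunc, cos_pi_div_two]
  simp

theorem hasDerivAt_left_piece (x : ℝ) :
    HasDerivAt (fun x => sin (kconst * x)) (kconst * cos (kconst * x)) x := by
  refine ((hasDerivAt_id x).const_mul kconst).sin.congr_deriv ?_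
  rw [id_eq, mul_one, mul_comm]

theorem hasDerivAt_right_piece (x : ℝ) :
    HasDerivAt (fun x => sin (kconst * x / √2 + π * (2 - √2) / 4))
      (kconst / √2 * cos (kconst * x / √2 + π * (2 - √2) / 4)) x := by
  refine ((((hasDerivAt_id x).const_mul kconst).div_const √2).add_const
    (π * (2 - √2) / 4)).sin.congr_deriv ?_
  rw [id_eq, mul_one, mul_comm]

theorem hasDerivAt_wfun (x : ℝ) : HasDerivAt wfun (wfunDeriv x) x := by
  rcases lt_trichotomy x xjunc with hx | rfl | hx
  · rw [wfunDeriv, if_pos hx.le]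
    refine (hasDerivAt_left_piece x).congr_of_eventuallyEq ?_
    filter_upwards [Iio_mem_nhds hx] with y hy
    exact if_pos (le_of_lt hy)
  · have hl : HasDerivWithinAt wfun (wfunDeriv xjunc) (Set.Iic xjunc) xjunc := by
      have h := (hasDerivAt_left_piece xjunc).hasDerivWithinAt (s := Set.Iic xjunc)
      rw [kconst_mul_xjunc, cos_pi_div_two, mul_zero, ← wfunDeriv_xjunc] at h
      exact h.congr (fun y hy => if_pos hy) (if_pos le_rfl)
    have hr : HasDerivWithinAt wfun (wfunDeriv xjunc) (Set.Ici xjunc) xjunc := by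
      have h := (hasDerivAt_right_piece xjunc).hasDerivWithinAt (s := Set.Ici xjunc)
      rw [right_phase_xjunc, cos_pi_div_two, mul_zero, ← wfunDeriv_xjunc] at h
      have heq : wfun xjunc = sin (kconst * xjunc / √2 + π * (2 - √2) / 4) := by
        rw [right_phase_xjunc, wfun, if_pos le_rfl, kconst_mul_xjunc]
      refine h.congr (fun y hy => ?_) heq
      rcases eq_or_lt_of_le (Set.mem_Ici.mp hy) with rfl | hlt
      · exact heq
      · exact if_neg hlt.not_ge
    simpa [Set.Iic_union_Ici] using hl.union hr
  · rw [wfunDeriv, if_neg hx.not_ge]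
    refine (hasDerivAt_right_piece x).congr_of_eventuallyEq ?_
    filter_upwards [Ioi_mem_nhds hx] with y hy
    exact if_neg (not_le_of_gt hy)

theorem deriv_wfun : deriv wfun = wfunDeriv :=
  funext fun x => (hasDerivAt_wfun x).deriv

theorem wfun_ode_left {x : ℝ} (hx : x < xjunc) :
    deriv (deriv wfun) x + kconst ^ 2 * wfun x = 0 := by
  have h : HasDerivAt wfunDeriv (kconst * (-sin (kconst * x) * (kconst * 1))) x := by
    refine ((((hasDerivAt_id x).const_mul kconst).cos).const_mul kconst).congr_of_eventuallyEq ?_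
    filter_upwards [Iio_mem_nhds hx] with y hy
    exact if_pos (le_of_lt hy)
  rw [deriv_wfun, h.deriv, wfun, if_pos hx.le]
  ring

theorem wfun_ode_right {x : ℝ} (hx : xjunc < x) :
    2 * deriv (deriv wfun) x + kconst ^ 2 * wfun x = 0 := by
  have hs : √2 ^ 2 = 2 := sq_sqrt (by norm_num)
  have h : HasDerivAt wfunDeriv (kconst / √2 *
      (-sin (kconst * x / √2 + π * (2 - √2) / 4) * (kconst * 1 / √2))) x := by
    refine (((((hasDerivAt_id x).const_mul kconst).div_const √2).add_const
      (π * (2 - √2) / 4)).cos.const_mul (kconst / √2)).congr_of_eventuallyEq ?_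
    filter_upwards [Ioi_mem_nhds hx] with y hy
    exact if_neg (not_le_of_gt hy)
  have hk : kconst / √2 * (kconst * 1 / √2) = kconst ^ 2 / 2 := by
    rw [mul_one, div_mul_div_comm, ← sq, ← sq, hs]
  rw [deriv_wfun, h.deriv, wfun, if_neg hx.not_ge]
  linear_combination (-2 * sin (kconst * x / √2 + π * (2 - √2) / 4)) * hk

theorem wfun_pos {x : ℝ} (hx : x ∈ Set.Ioo 0 π) : 0 < wfun x := by
  have hk := kconst_pos
  rcases le_or_gt x xjunc with h | h
  · rw [wfun, if_pos h]
    refine sin_pos_of_pos_of_lt_pi (mul_pos hk hx.1) ?_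
    have := mul_le_mul_of_nonneg_left h hk.le
    rw [kconst_mul_xjunc] at this
    linarith [pi_pos]
  · rw [wfun, if_neg h.not_ge]
    have h1 : kconst * xjunc / √2 < kconst * x / √2 := by gcongr
    have h2 : kconst * x / √2 < kconst * π / √2 := by
      have := hx.2
      gcongr
    refine sin_pos_of_pos_of_lt_pi ?_ ?_
    · linarith [right_phase_xjunc, pi_pos]
    · linarith [right_phase_pi]

/-- w vanishes at 0 and π, is positive on (0,π), is C¹ on [0,π] with
w′(x₀) = 0, and satisfies w″ + k²w = 0 on (0,x₀), 2w″ + k²w = 0 on (x₀,π); i.e. with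
a = 1 on [0,x₀) and a = 2 on [x₀,π], it satisfies a·w″ + k²·w = 0 on (0,π) ∖ {x₀}. -/
theorem piecewise_eigenfunction_properties :
    wfun 0 = 0 ∧ wfun Real.pi = 0 ∧
    (∀ x ∈ Set.Ioo 0 Real.pi, 0 < wfun x) ∧
    (∃ w' : ℝ → ℝ, ContinuousOn w' (Set.Icc 0 Real.pi) ∧
      (∀ x ∈ Set.Icc 0 Real.pi, HasDerivWithinAt wfun (w' x) (Set.Icc 0 Real.pi) x) ∧
      w' xjunc = 0) ∧
    (∀ x ∈ Set.Ioo 0 xjunc, deriv (deriv wfun) x + kconst ^ 2 * wfun x = 0) ∧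
    (∀ x ∈ Set.Ioo xjunc Real.pi, 2 * deriv (deriv wfun) x + kconst ^ 2 * wfun x = 0) ∧
    (∀ x ∈ Set.Ioo 0 Real.pi, x ≠ xjunc →
      (if x < xjunc then (1 : ℝ) else 2) * deriv (deriv wfun) x + kconst ^ 2 * wfun x = 0) := by
  refine ⟨?_, ?_, fun x hx => wfun_pos hx, ⟨wfunDeriv, continuous_wfunDeriv.continuousOn,
    fun x _ => (hasDerivAt_wfun x).hasDerivWithinAt, wfunDeriv_xjunc⟩,
    fun x hx => wfun_ode_left hx.2, fun x hx => wfun_ode_right hx.1, fun x _ hne => ?_⟩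
  · rw [wfun, if_pos xjunc_pos.le, mul_zero, sin_zero]
  · rw [wfun, if_neg xjunc_lt_pi.not_ge, right_phase_pi, sin_pi]
  · rcases hne.lt_or_gt with h | h
    · rw [if_pos h, one_mul]
      exact wfun_ode_left h
    · rw [if_neg h.not_gt]
      exact wfun_ode_right h
end
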